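/- arXiv:2406.17098 — 11 statements merged into one kernel-verified Lean document; each statement's English description precedes it below -/
import Mathlib

section
/- Let P be a row-stochastic matrix on a finite nonempty state space S and γ ∈ (0,1). Then for all states s, w, g ∈ S, the Laplace transform of the hitting time is supermultiplicative along waypoints: L γ P s g ≥ L γ P s w · L γ P w g. -/
open scoped BigOperators

variable {S : Type*} [Fintype S] [DecidableEq S] [Nonempty S]

/-- `P` is a row-stochastic matrix. -/
def IsStochastic (P : Matrix S S ℝ) : Prop :=
  (∀ s s', 0 ≤ P s s') ∧ ∀ s, ∑ s', P s s' = 1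

/-- Discounted state occupancy measure `occ γ P s g = (1-γ) Σ_t γ^t (P^t) s g`. -/
noncomputable def occ (γ : ℝ) (P : Matrix S S ℝ) (s g : S) : ℝ :=
  (1 - γ) * ∑' t : ℕ, γ ^ t * (P ^ t) s g

/-- First-passage (hitting-time) probabilities of a Markov chain. -/
noncomputable def fp {X : Type*} [Fintype X] [DecidableEq X] (M : Matrix X X ℝ) :
    ℕ → X → X → ℝ
  | 0, x, y => if x = y then 1 else 0
  | h + 1, x, y => if x = y then 0 else ∑ x' : X, M x x' * fp M h x' y

/-- Laplace transform of the hitting time: `L γ M x y = Σ_h γ^h f h x y`. -/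
noncomputable def Lhit {X : Type*} [Fintype X] [DecidableEq X]
    (γ : ℝ) (M : Matrix X X ℝ) (x y : X) : ℝ :=
  ∑' h : ℕ, γ ^ h * fp M h x y

theorem fp_nonneg' (P : Matrix S S ℝ) (hP : IsStochastic P) (h : ℕ) (x y : S) :
    0 ≤ fp P h x y := by
  induction h generalizing x with
  | zero => simp only [fp]; split_ifs <;> norm_num
  | succ n ih =>
    simp only [fp]
    split_ifs
    · exact le_rfl
    · exact Finset.sum_nonneg fun i _ => mul_nonneg (hP.1 _ _) (ih i)

theorem part_succ (γ : ℝ) (P : Matrix S S ℝ) (N : ℕ) (x y : S) :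
    ∑ h ∈ Finset.range (N + 1), γ ^ h * fp P h x y =
      if x = y then 1 else
        γ * ∑ x', P x x' * ∑ h ∈ Finset.range N, γ ^ h * fp P h x' y := by
  rw [Finset.sum_range_succ']
  by_cases hxy : x = y
  · simp [fp, hxy]
  · simp only [fp, hxy, if_false, Finset.mul_sum, mul_zero, add_zero]
    rw [Finset.sum_comm]
    refine Finset.sum_congr rfl fun i _ => Finset.sum_congr rfl fun j _ => ?_
    ring

theorem part_le_one (γ : ℝ) (hγ0 : 0 < γ) (hγ1 : γ < 1)
    (P : Matrix S S ℝ) (hP : IsStochastic P) (N : ℕ) (x y : S) :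
    ∑ h ∈ Finset.range N, γ ^ h * fp P h x y ≤ 1 := by
  induction N generalizing x with
  | zero => simp
  | succ n ih =>
    rw [part_succ]
    split_ifs
    · exact le_rfl
    · have h1 : ∑ x', P x x' * ∑ h ∈ Finset.range n, γ ^ h * fp P h x' y ≤ 1 := by
        rw [← hP.2 x]
        exact Finset.sum_le_sum fun i _ => mul_le_of_le_one_right (hP.1 _ _) (ih i)
      nlinarith

theorem term_nonneg (γ : ℝ) (hγ0 : 0 < γ)
    (P : Matrix S S ℝ) (hP : IsStochastic P) (x y : S) (h : ℕ) :
    0 ≤ γ ^ h * fp P h x y :=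
  mul_nonneg (pow_nonneg hγ0.le _) (fp_nonneg' P hP h x y)

theorem Lhit_tendsto (γ : ℝ) (hγ0 : 0 < γ) (hγ1 : γ < 1)
    (P : Matrix S S ℝ) (hP : IsStochastic P) (x y : S) :
    Filter.Tendsto (fun N => ∑ h ∈ Finset.range N, γ ^ h * fp P h x y) Filter.atTop
      (nhds (Lhit γ P x y)) :=
  (summable_of_sum_range_le (term_nonneg γ hγ0 P hP x y)
    (fun n => part_le_one γ hγ0 hγ1 P hP n x y)).hasSum.tendsto_sum_nat

theorem Lhit_eq (γ : ℝ) (hγ0 : 0 < γ) (hγ1 : γ < 1)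
    (P : Matrix S S ℝ) (hP : IsStochastic P) (x y : S) :
    Lhit γ P x y = if x = y then 1 else γ * ∑ x', P x x' * Lhit γ P x' y := by
  have h1 := (Filter.tendsto_add_atTop_iff_nat 1).2 (Lhit_tendsto γ hγ0 hγ1 P hP x y)
  simp only [part_succ] at h1
  refine tendsto_nhds_unique h1 ?_
  split_ifs
  · exact tendsto_const_nhds
  · exact (tendsto_finsetSum _ fun i _ =>
      (Lhit_tendsto γ hγ0 hγ1 P hP i y).const_mul _).const_mul _

theorem part_mul_le (γ : ℝ) (hγ0 : 0 < γ) (hγ1 : γ < 1)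
    (P : Matrix S S ℝ) (hP : IsStochastic P) (w g : S) (N : ℕ) (s : S) :
    (∑ h ∈ Finset.range N, γ ^ h * fp P h s w) * Lhit γ P w g ≤ Lhit γ P s g := by
  have h0 : ∀ x, 0 ≤ Lhit γ P x g := fun x => tsum_nonneg (term_nonneg γ hγ0 P hP x g)
  have hl : Lhit γ P w g ≤ 1 := le_of_tendsto' (Lhit_tendsto γ hγ0 hγ1 P hP w g)
    fun n => part_le_one γ hγ0 hγ1 P hP n w g
  induction N generalizing s with
  | zero => simpa using h0 s
  | succ n ih =>
    by_cases hsg : s = g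
    · rw [Lhit_eq γ hγ0 hγ1 P hP s g, if_pos hsg]
      exact mul_le_one₀ (part_le_one γ hγ0 hγ1 P hP _ _ _) (h0 w) hl
    · rw [part_succ]
      by_cases hsw : s = w
      · simp [hsw]
      · rw [if_neg hsw, Lhit_eq γ hγ0 hγ1 P hP s g, if_neg hsg, mul_assoc, Finset.sum_mul]
        refine mul_le_mul_of_nonneg_left (Finset.sum_le_sum fun i _ => ?_) hγ0.le
        rw [mul_assoc]
        exact mul_le_mul_of_nonneg_left (ih i) (hP.1 _ _)

/-- The Laplace transform of the hitting time is supermultiplicative along waypoints. -/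
theorem Lhit_waypoint (γ : ℝ) (hγ0 : 0 < γ) (hγ1 : γ < 1)
    (P : Matrix S S ℝ) (hP : IsStochastic P) (s w g : S) :
    Lhit γ P s g ≥ Lhit γ P s w * Lhit γ P w g := by
  exact le_of_tendsto' ((Lhit_tendsto γ hγ0 hγ1 P hP s w).mul_const _)
    fun n => part_mul_le γ hγ0 hγ1 P hP w g n s
end

section
/- Let P be a row-stochastic matrix on a finite nonempty state space S and γ ∈ (0,1). Then for all states s, g ∈ S, occ γ P s g ≤ occ γ P g g. (Positivity of the successor distance in the uncontrolled case: the discounted occupancy of g from any state s is at most the discounted occupancy of g from g itself.) -/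
open scoped BigOperators

variable {S : Type*} [Fintype S] [DecidableEq S] [Nonempty S]

theorem pow_bounds (P : Matrix S S ℝ) (hP : IsStochastic P) (t : ℕ) :
    ∀ s g, 0 ≤ (P ^ t) s g ∧ (P ^ t) s g ≤ 1 := by
  induction t with
  | zero =>
    intro s g
    rw [pow_zero, Matrix.one_apply]
    split_ifs <;> norm_num
  | succ t ih =>
    intro s g
    rw [pow_succ', Matrix.mul_apply]
    refine ⟨Finset.sum_nonneg fun i _ => mul_nonneg (hP.1 s i) (ih i g).1, ?_⟩
    rw [← hP.2 s]
    exact Finset.sum_le_sum fun i _ => mul_le_of_le_one_right (hP.1 s i) (ih i g).2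

theorem summable_occ (γ : ℝ) (hγ0 : 0 < γ) (hγ1 : γ < 1)
    (P : Matrix S S ℝ) (hP : IsStochastic P) (s g : S) :
    Summable fun t : ℕ => γ ^ t * (P ^ t) s g :=
  Summable.of_nonneg_of_le
    (fun t => mul_nonneg (pow_nonneg hγ0.le t) (pow_bounds P hP t s g).1)
    (fun t => mul_le_of_le_one_right (pow_nonneg hγ0.le t) (pow_bounds P hP t s g).2)
    (summable_geometric_of_lt_one hγ0.le hγ1)

theorem bellman (γ : ℝ) (hγ0 : 0 < γ) (hγ1 : γ < 1)
    (P : Matrix S S ℝ) (hP : IsStochastic P) (s g : S) (hsg : s ≠ g) :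
    ∑' t : ℕ, γ ^ t * (P ^ t) s g = γ * ∑ i, P s i * ∑' t : ℕ, γ ^ t * (P ^ t) i g := by
  have hs := summable_occ γ hγ0 hγ1 P hP
  rw [(hs s g).tsum_eq_zero_add]
  simp only [pow_zero, Matrix.one_apply_ne hsg, mul_zero, zero_add]
  simp_rw [← tsum_mul_left]
  rw [← Summable.tsum_finsetSum (fun i _ => (hs i g).mul_left _), ← tsum_mul_left]
  refine tsum_congr fun t => ?_
  rw [pow_succ' P, Matrix.mul_apply, Finset.mul_sum, Finset.mul_sum]
  refine Finset.sum_congr rfl fun i _ => ?_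
  ring

/-- The discounted occupancy of `g` from any `s` is at most that from `g` itself. -/
theorem occ_le_occ_self (γ : ℝ) (hγ0 : 0 < γ) (hγ1 : γ < 1)
    (P : Matrix S S ℝ) (hP : IsStochastic P) (s g : S) :
    occ γ P s g ≤ occ γ P g g := by
  unfold occ
  refine mul_le_mul_of_nonneg_left ?_ (by linarith)
  obtain ⟨m, hm⟩ := Finite.exists_max fun x : S => ∑' t : ℕ, γ ^ t * (P ^ t) x g
  by_cases h : m = g
  · subst h
    exact hm s
  · have hb := bellman γ hγ0 hγ1 P hP m g h
    have h1 : ∑ i, P m i * ∑' t : ℕ, γ ^ t * (P ^ t) i g ≤ ∑' t : ℕ, γ ^ t * (P ^ t) m g := by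
      calc _ ≤ ∑ i, P m i * ∑' t : ℕ, γ ^ t * (P ^ t) m g :=
            Finset.sum_le_sum fun i _ => mul_le_mul_of_nonneg_left (hm i) (hP.1 m i)
        _ = _ := by rw [← Finset.sum_mul, hP.2, one_mul]
    have h2 : 0 ≤ ∑' t : ℕ, γ ^ t * (P ^ t) g g :=
      tsum_nonneg fun t => mul_nonneg (pow_nonneg hγ0.le t) (pow_bounds P hP t g g).1
    have h3 := mul_le_mul_of_nonneg_left h1 hγ0.le
    have h4 := hm s
    nlinarith
end

section
/- Let P be a row-stochastic matrix on a finite nonempty state space S and γ ∈ (0,1). Then for all states s, w, g ∈ S, the discounted occupancies satisfy the multiplicative triangle inequality occ γ P s g · occ γ P w w ≥ occ γ P s w · occ γ P w g. (Equivalently, when all occupancies are positive, the successor distance d(s,g) = log(occ γ P g g) − log(occ γ P s g) satisfies d(s,g) ≤ d(s,w) + d(w,g).) -/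
open scoped BigOperators

variable {S : Type*} [Fintype S] [DecidableEq S] [Nonempty S]

lemma aux_pow_nonneg {P : Matrix S S ℝ} (hP : IsStochastic P) (t : ℕ) :
    (∀ x y, 0 ≤ (P ^ t) x y) ∧ ∀ x y, (P ^ t) x y ≤ 1 := by
  induction t with
  | zero =>
    constructor <;> intro x y <;> simp only [pow_zero, Matrix.one_apply] <;> split_ifs <;> norm_num
  | succ k ih =>
    constructor <;> intro x y <;> rw [pow_succ', Matrix.mul_apply]
    · exact Finset.sum_nonneg fun z _ => mul_nonneg (hP.1 _ _) (ih.1 _ _)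
    · calc ∑ z, P x z * (P ^ k) z y ≤ ∑ z, P x z :=
            Finset.sum_le_sum fun z _ => mul_le_of_le_one_right (hP.1 _ _) (ih.2 _ _)
        _ = 1 := hP.2 x

lemma aux_summable {γ : ℝ} (hγ0 : 0 < γ) (hγ1 : γ < 1) {P : Matrix S S ℝ}
    (hP : IsStochastic P) (x y : S) : Summable fun t : ℕ => γ ^ t * (P ^ t) x y :=
  Summable.of_nonneg_of_le
    (fun t => mul_nonneg (pow_nonneg hγ0.le t) ((aux_pow_nonneg hP t).1 x y))
    (fun t => mul_le_of_le_one_right (pow_nonneg hγ0.le t) ((aux_pow_nonneg hP t).2 x y))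
    (summable_geometric_of_lt_one hγ0.le hγ1)

lemma aux_occ_nonneg {γ : ℝ} (hγ0 : 0 < γ) (hγ1 : γ < 1) {P : Matrix S S ℝ}
    (hP : IsStochastic P) (x y : S) : 0 ≤ occ γ P x y :=
  mul_nonneg (by linarith) (tsum_nonneg fun t =>
    mul_nonneg (pow_nonneg hγ0.le t) ((aux_pow_nonneg hP t).1 x y))

lemma aux_occ_rec {γ : ℝ} (hγ0 : 0 < γ) (hγ1 : γ < 1) {P : Matrix S S ℝ}
    (hP : IsStochastic P) (x y : S) :
    occ γ P x y = (1 - γ) * (if x = y then 1 else 0) + γ * ∑ z, P x z * occ γ P z y := by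
  have h : ∑' t : ℕ, γ ^ (t + 1) * (P ^ (t + 1)) x y
      = γ * ∑ z, P x z * ∑' t : ℕ, γ ^ t * (P ^ t) z y := by
    simp_rw [← tsum_mul_left]
    rw [← Summable.tsum_finsetSum
      (fun z _ => (aux_summable hγ0 hγ1 hP z y).mul_left (P x z)), ← tsum_mul_left]
    refine tsum_congr fun t => ?_
    rw [pow_succ' P, Matrix.mul_apply, Finset.mul_sum, Finset.mul_sum]
    exact Finset.sum_congr rfl fun z _ => by ring
  unfold occ
  rw [(aux_summable hγ0 hγ1 hP x y).tsum_eq_zero_add, h]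
  simp only [pow_zero, one_mul, Matrix.one_apply]
  rw [mul_add]
  congr 1
  simp only [Finset.mul_sum]
  exact Finset.sum_congr rfl fun z _ => by ring

/-- Multiplicative triangle inequality for discounted occupancies. -/
theorem occ_triangle (γ : ℝ) (hγ0 : 0 < γ) (hγ1 : γ < 1)
    (P : Matrix S S ℝ) (hP : IsStochastic P) (s w g : S) :
    occ γ P s g * occ γ P w w ≥ occ γ P s w * occ γ P w g := by
  set v : S → ℝ := fun x => occ γ P x g * occ γ P w w - occ γ P x w * occ γ P w g with hv
  obtain ⟨m, hm⟩ := Finite.exists_min v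
  have hm0 : 0 ≤ v m := by
    by_cases hmw : m = w
    · rw [hmw]; simp only [hv]; linarith [mul_comm (occ γ P w g) (occ γ P w w)]
    · have e : v m = (1 - γ) * (if m = g then 1 else 0) * occ γ P w w
          + γ * ∑ z, P m z * v z := by
        have e1 : ∑ z, P m z * v z = (∑ z, P m z * occ γ P z g) * occ γ P w w
            - (∑ z, P m z * occ γ P z w) * occ γ P w g := by
          rw [Finset.sum_mul, Finset.sum_mul, ← Finset.sum_sub_distrib]
          exact Finset.sum_congr rfl fun z _ => by simp only [hv]; ring
        have e2 := aux_occ_rec hγ0 hγ1 hP m g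
        have e3 := aux_occ_rec hγ0 hγ1 hP m w
        rw [if_neg hmw] at e3
        rw [e1]
        change occ γ P m g * occ γ P w w - occ γ P m w * occ γ P w g = _
        rw [e2, e3]; ring
      have h1 : v m ≤ ∑ z, P m z * v z := by
        calc v m = ∑ z, P m z * v m := by rw [← Finset.sum_mul, hP.2, one_mul]
          _ ≤ _ := Finset.sum_le_sum fun z _ => mul_le_mul_of_nonneg_left (hm z) (hP.1 _ _)
      have h2 : 0 ≤ (1 - γ) * (if m = g then 1 else 0) * occ γ P w w := by
        refine mul_nonneg (mul_nonneg (by linarith) ?_) (aux_occ_nonneg hγ0 hγ1 hP w w)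
        split_ifs <;> norm_num
      have h3 := mul_le_mul_of_nonneg_left h1 hγ0.le
      nlinarith
  have := hm0.trans (hm s)
  simp only [hv] at this
  linarith
end

section
/- Consider a controlled Markov process with finite nonempty state space S, finite nonempty action space A, row-stochastic dynamics P : S → A → S → ℝ, and discount γ ∈ (0,1). Then for any states s, w, g ∈ S and any stationary stochastic policy π ∈ Π, the waypoint inequality holds: (⨆_{π' ∈ Π} occ γ π' w g) · occ γ π s w / occ γ π w w ≤ ⨆_{π' ∈ Π} occ γ π' s g. (Paper's Lemma 4.5: reaching g through the waypoint w is no more likely than reaching g optimally.) -/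
open scoped BigOperators

variable {S A : Type*} [Fintype S] [DecidableEq S] [Nonempty S]
  [Fintype A] [DecidableEq A] [Nonempty A]

/-- Row-stochastic controlled dynamics. -/
def IsDynamics (P : S → A → S → ℝ) : Prop :=
  (∀ s a s', 0 ≤ P s a s') ∧ ∀ s a, ∑ s', P s a s' = 1

/-- Stationary stochastic policy. -/
def IsPolicy (π : S → A → ℝ) : Prop :=
  (∀ s a, 0 ≤ π s a) ∧ ∀ s, ∑ a, π s a = 1

/-- The set of stationary stochastic policies, as a subtype. -/
abbrev Pol (S A : Type*) [Fintype A] : Type _ := {π : S → A → ℝ // IsPolicy π}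

/-- State-transition matrix induced by policy `π`. -/
noncomputable def Pmat (P : S → A → S → ℝ) (π : S → A → ℝ) : Matrix S S ℝ :=
  fun s s' => ∑ a, π s a * P s a s'

/-- Discounted state occupancy measure under policy `π`. -/
noncomputable def occC (γ : ℝ) (P : S → A → S → ℝ) (π : S → A → ℝ) (s g : S) : ℝ :=
  (1 - γ) * ∑' t : ℕ, γ ^ t * ((Pmat P π) ^ t) s g

theorem wp_maxprin (γ : ℝ) (hγ0 : 0 < γ) (hγ1 : γ < 1) (M : S → S → ℝ)
    (h0 : ∀ s s', 0 ≤ M s s') (h1 : ∀ s, ∑ s', M s s' = 1) (D : S → ℝ)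
    (hD : ∀ s, 0 ≤ D s ∨ γ * ∑ s', M s s' * D s' ≤ D s) (s : S) : 0 ≤ D s := by
  obtain ⟨m, hm⟩ := Finite.exists_min D
  refine le_trans ?_ (hm s)
  rcases hD m with h | h
  · exact h
  · have h2 : D m ≤ ∑ s', M m s' * D s' := by
      calc D m = ∑ s', M m s' * D m := by rw [← Finset.sum_mul, h1, one_mul]
        _ ≤ _ := Finset.sum_le_sum fun i _ => mul_le_mul_of_nonneg_left (hm i) (h0 _ _)
    have h3 := mul_le_mul_of_nonneg_left h2 hγ0.le
    by_contra hneg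
    push Not at hneg
    nlinarith

theorem wp_pow (M : Matrix S S ℝ)
    (h0 : ∀ s s', 0 ≤ M s s') (h1 : ∀ s, ∑ s', M s s' = 1) (t : ℕ) :
    ∀ s g, 0 ≤ (M ^ t) s g ∧ (M ^ t) s g ≤ 1 := by
  induction t with
  | zero =>
    intro s g
    rw [pow_zero, Matrix.one_apply]
    split_ifs <;> norm_num
  | succ t ih =>
    intro s g
    rw [pow_succ', Matrix.mul_apply]
    refine ⟨Finset.sum_nonneg fun i _ => mul_nonneg (h0 _ _) (ih _ _).1, ?_⟩
    calc _ ≤ ∑ i, M s i := Finset.sum_le_sum fun i _ =>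
          mul_le_of_le_one_right (h0 _ _) (ih _ _).2
      _ = 1 := h1 s

theorem wp_P0 (P : S → A → S → ℝ) (hP : IsDynamics P) (π : S → A → ℝ) (hπ : IsPolicy π)
    (s s' : S) : 0 ≤ Pmat P π s s' :=
  Finset.sum_nonneg fun a _ => mul_nonneg (hπ.1 _ _) (hP.1 _ _ _)

theorem wp_P1 (P : S → A → S → ℝ) (hP : IsDynamics P) (π : S → A → ℝ) (hπ : IsPolicy π)
    (s : S) : ∑ s', Pmat P π s s' = 1 := by
  unfold Pmat
  rw [Finset.sum_comm]
  simp_rw [← Finset.mul_sum, hP.2, mul_one]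
  exact hπ.2 s

theorem wp_PV (P : S → A → S → ℝ) (π : S → A → ℝ) (V : S → ℝ) (s : S) :
    ∑ s', Pmat P π s s' * V s' = ∑ a, π s a * ∑ s', P s a s' * V s' := by
  unfold Pmat
  simp_rw [Finset.sum_mul, Finset.mul_sum]
  rw [Finset.sum_comm]
  simp_rw [mul_assoc]

theorem wp_occ (γ : ℝ) (hγ0 : 0 < γ) (hγ1 : γ < 1)
    (P : S → A → S → ℝ) (hP : IsDynamics P)
    (π : S → A → ℝ) (hπ : IsPolicy π) (s g : S) :
    occC γ P π s g = (if s = g then 1 - γ else 0)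
      + γ * ∑ s', Pmat P π s s' * occC γ P π s' g := by
  have hb := wp_pow (Pmat P π) (wp_P0 P hP π hπ) (wp_P1 P hP π hπ)
  have hs : ∀ s, Summable fun t : ℕ => γ ^ t * ((Pmat P π) ^ t) s g := fun s =>
    Summable.of_nonneg_of_le (fun t => mul_nonneg (pow_nonneg hγ0.le _) (hb t s g).1)
      (fun t => mul_le_of_le_one_right (pow_nonneg hγ0.le _) (hb t s g).2)
      (summable_geometric_of_lt_one hγ0.le hγ1)
  have key : ∑' t : ℕ, γ ^ (t+1) * ((Pmat P π) ^ (t+1)) s g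
      = γ * ∑ s', Pmat P π s s' * ∑' t : ℕ, γ ^ t * ((Pmat P π) ^ t) s' g := by
    simp_rw [← tsum_mul_left]
    rw [← Summable.tsum_finsetSum (fun i _ => (hs i).mul_left _), ← tsum_mul_left]
    refine tsum_congr fun t => ?_
    rw [pow_succ' (Pmat P π), Matrix.mul_apply, Finset.mul_sum, Finset.mul_sum]
    refine Finset.sum_congr rfl fun i _ => ?_
    ring
  unfold occC
  rw [(hs s).tsum_eq_zero_add, key]
  simp only [pow_zero, one_mul, Matrix.one_apply, mul_add]
  congr 1
  · split_ifs <;> simp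
  · simp only [Finset.mul_sum]
    refine Finset.sum_congr rfl fun i _ => ?_
    ring

/-- Bellman optimality operator. -/
noncomputable def wpT (γ : ℝ) (P : S → A → S → ℝ) (g : S) (V : S → ℝ) (s : S) : ℝ :=
  (if s = g then 1 - γ else 0) + γ * Finset.univ.sup' Finset.univ_nonempty
    (fun a : A => ∑ s', P s a s' * V s')

theorem wp_T_le (γ : ℝ) (hγ0 : 0 < γ) (P : S → A → S → ℝ) (hP : IsDynamics P) (g : S)
    (V W : S → ℝ) (s : S) : wpT γ P g V s ≤ wpT γ P g W s + γ * dist V W := by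
  unfold wpT
  rw [add_assoc, ← mul_add]
  gcongr
  refine Finset.sup'_le _ _ fun a _ => ?_
  calc ∑ s', P s a s' * V s' ≤ ∑ s', (P s a s' * W s' + P s a s' * dist V W) := by
        refine Finset.sum_le_sum fun i _ => ?_
        rw [← mul_add]
        refine mul_le_mul_of_nonneg_left ?_ (hP.1 _ _ _)
        have := dist_le_pi_dist V W i
        rw [Real.dist_eq] at this
        linarith [le_abs_self (V i - W i)]
    _ = ∑ s', P s a s' * W s' + dist V W := by
        rw [Finset.sum_add_distrib, ← Finset.sum_mul, hP.2, one_mul]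
    _ ≤ _ := by
        gcongr
        exact Finset.le_sup' (fun a : A => ∑ s', P s a s' * W s') (Finset.mem_univ a)

theorem wp_fix (γ : ℝ) (hγ0 : 0 < γ) (hγ1 : γ < 1)
    (P : S → A → S → ℝ) (hP : IsDynamics P) (g : S) : ∃ V : S → ℝ, wpT γ P g V = V := by
  have hc : ContractingWith ⟨γ, hγ0.le⟩ (wpT γ P g) := by
    refine ⟨by exact_mod_cast hγ1, LipschitzWith.of_dist_le_mul fun V W => ?_⟩
    change _ ≤ γ * dist V W
    rw [dist_pi_le_iff (by positivity)]
    intro s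
    rw [Real.dist_eq, abs_le]
    have h1 := wp_T_le γ hγ0 P hP g V W s
    have h2 := wp_T_le γ hγ0 P hP g W V s
    rw [dist_comm] at h2
    constructor <;> linarith
  exact ⟨_, hc.fixedPoint_isFixedPt⟩

theorem wp_opt (γ : ℝ) (hγ0 : 0 < γ) (hγ1 : γ < 1)
    (P : S → A → S → ℝ) (hP : IsDynamics P) (g : S) : ∃ V : S → ℝ,
    (∀ s, (⨆ π' : Pol S A, occC γ P π'.1 s g) = V s) ∧ (∀ s, 0 ≤ V s) ∧
    ∀ π, IsPolicy π → ∀ s, γ * ∑ s', Pmat P π s s' * V s' ≤ V s := by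
  obtain ⟨V, hV⟩ := wp_fix γ hγ0 hγ1 P hP g
  have hr : ∀ s, (0:ℝ) ≤ if s = g then 1 - γ else 0 := fun s => by split_ifs <;> linarith
  have hsup : ∀ π, IsPolicy π → ∀ s,
      (if s = g then 1 - γ else 0) + γ * ∑ s', Pmat P π s s' * V s' ≤ V s := by
    intro π hπ s
    conv_rhs => rw [← hV]
    unfold wpT
    gcongr
    rw [wp_PV]
    calc _ ≤ ∑ a, π s a * Finset.univ.sup' Finset.univ_nonempty
          (fun a : A => ∑ s', P s a s' * V s') := Finset.sum_le_sum fun a _ =>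
            mul_le_mul_of_nonneg_left
              (Finset.le_sup' (fun a : A => ∑ s', P s a s' * V s') (Finset.mem_univ a)) (hπ.1 _ _)
      _ = _ := by rw [← Finset.sum_mul, hπ.2, one_mul]
  have hle : ∀ π, IsPolicy π → ∀ s, occC γ P π s g ≤ V s := by
    intro π hπ s
    have := wp_maxprin γ hγ0 hγ1 (Pmat P π) (wp_P0 P hP π hπ) (wp_P1 P hP π hπ)
      (fun s => V s - occC γ P π s g) (fun s => Or.inr ?_) s
    · linarith
    · have h1 := hsup π hπ s
      have h2 := wp_occ γ hγ0 hγ1 P hP π hπ s g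
      simp only [mul_sub, Finset.sum_sub_distrib]
      linarith
  have hex : ∀ s, ∃ a : A, Finset.univ.sup' Finset.univ_nonempty
      (fun a : A => ∑ s', P s a s' * V s') = ∑ s', P s a s' * V s' := fun s => by
    obtain ⟨a, _, ha⟩ := Finset.exists_mem_eq_sup' (Finset.univ_nonempty)
      (fun a : A => ∑ s', P s a s' * V s')
    exact ⟨a, ha⟩
  choose f hf using hex
  let p : S → A → ℝ := fun s a => if a = f s then 1 else 0
  have hp : IsPolicy p := ⟨fun s a => by dsimp only [p]; split_ifs <;> norm_num,
    fun s => by simp [p]⟩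
  have hpV : ∀ s, V s = (if s = g then 1 - γ else 0) + γ * ∑ s', Pmat P p s s' * V s' := by
    intro s
    conv_lhs => rw [← hV]
    unfold wpT
    rw [hf, wp_PV]
    simp [p]
  have hge : ∀ s, V s ≤ occC γ P p s g := by
    intro s
    have := wp_maxprin γ hγ0 hγ1 (Pmat P p) (wp_P0 P hP p hp) (wp_P1 P hP p hp)
      (fun s => occC γ P p s g - V s) (fun s => Or.inr ?_) s
    · linarith
    · have h1 := hpV s
      have h2 := wp_occ γ hγ0 hγ1 P hP p hp s g
      simp only [mul_sub, Finset.sum_sub_distrib]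
      linarith
  refine ⟨V, fun s => ?_, ?_, fun π hπ s => by linarith [hsup π hπ s, hr s]⟩
  · haveI : Nonempty (Pol S A) := ⟨⟨p, hp⟩⟩
    apply le_antisymm
    · exact ciSup_le fun π' => hle π'.1 π'.2 s
    · exact (hge s).trans (le_ciSup (f := fun π' : Pol S A => occC γ P π'.1 s g)
        ⟨V s, by rintro _ ⟨π', rfl⟩; exact hle π'.1 π'.2 s⟩ ⟨p, hp⟩)
  · exact wp_maxprin γ hγ0 hγ1 (Pmat P p) (wp_P0 P hP p hp) (wp_P1 P hP p hp) V
      fun s => Or.inr (by linarith [hsup p hp s, hr s])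

/-- Waypoint inequality: reaching `g` through the waypoint `w` is no more likely
than reaching `g` optimally. -/
theorem waypoint_inequality (γ : ℝ) (hγ0 : 0 < γ) (hγ1 : γ < 1)
    (P : S → A → S → ℝ) (hP : IsDynamics P)
    (π : S → A → ℝ) (hπ : IsPolicy π) (s w g : S) :
    (⨆ π' : Pol S A, occC γ P π'.1 w g) * occC γ P π s w / occC γ P π w w ≤
      ⨆ π' : Pol S A, occC γ P π'.1 s g := by
  obtain ⟨V, hV, hV0, hsup⟩ := wp_opt γ hγ0 hγ1 P hP g
  rw [hV, hV]
  have hM0 := wp_P0 P hP π hπ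
  have hM1 := wp_P1 P hP π hπ
  have ho := fun s => wp_occ γ hγ0 hγ1 P hP π hπ s w
  have hr : ∀ s, (0:ℝ) ≤ if s = w then 1 - γ else 0 := fun s => by split_ifs <;> linarith
  have hnn : ∀ s, 0 ≤ occC γ P π s w :=
    wp_maxprin γ hγ0 hγ1 (Pmat P π) hM0 hM1 (fun s => occC γ P π s w)
      fun s => Or.inr (by linarith [ho s, hr s])
  have hpos : 0 < occC γ P π w w := by
    rw [ho w, if_pos rfl]
    have : 0 ≤ ∑ s', Pmat P π w s' * occC γ P π s' w :=
      Finset.sum_nonneg fun i _ => mul_nonneg (hM0 _ _) (hnn _)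
    have := mul_nonneg hγ0.le this
    linarith
  rw [div_le_iff₀ hpos]
  have := wp_maxprin γ hγ0 hγ1 (Pmat P π) hM0 hM1
    (fun s => V s * occC γ P π w w - V w * occC γ P π s w) (fun s => ?_) s
  · linarith
  · by_cases hs : s = w
    · left
      subst hs
      simp
    · right
      have h1 := mul_le_mul_of_nonneg_right (hsup π hπ s) hpos.le
      have h2 := ho s
      rw [if_neg hs, zero_add] at h2
      have e : γ * ∑ s', Pmat P π s s' * (V s' * occC γ P π w w - V w * occC γ P π s' w)
          = (γ * ∑ s', Pmat P π s s' * V s') * occC γ P π w w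
            - V w * (γ * ∑ s', Pmat P π s s' * occC γ P π s' w) := by
        simp only [Finset.mul_sum, Finset.sum_mul]
        rw [← Finset.sum_sub_distrib]
        refine Finset.sum_congr rfl fun i _ => ?_
        ring
      rw [← h2] at e
      simp only [e]
      linarith
end

section
/- Consider a controlled Markov process with finite nonempty state space S, finite nonempty action space A, row-stochastic dynamics P : S → A → S → ℝ, and discount γ ∈ (0,1). Define the multiplicative successor value D s g = ⨆_{π ∈ Π} occ γ π s g / occ γ π g g. Then D s g ≤ 1 for all s, g ∈ S. (Positivity part of the paper's Theorem 4.6: the successor distance d_SD(s,g) = −log D s g is nonnegative.) -/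
open scoped BigOperators

variable {S A : Type*} [Fintype S] [DecidableEq S] [Nonempty S]
  [Fintype A] [DecidableEq A] [Nonempty A]

/-- Multiplicative successor value `D s g = ⨆_π occ γ π s g / occ γ π g g`. -/
noncomputable def Dval (γ : ℝ) (P : S → A → S → ℝ) (s g : S) : ℝ :=
  ⨆ π : Pol S A, occC γ P π.1 s g / occC γ P π.1 g g

lemma Pmat_pow_aux (P : S → A → S → ℝ) (hP : IsDynamics P) (π : S → A → ℝ) (hπ : IsPolicy π) :
    (∀ s s', 0 ≤ Pmat P π s s') ∧ (∀ s, ∑ s', Pmat P π s s' = 1) ∧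
    ∀ (t : ℕ) (s g : S), 0 ≤ (Pmat P π ^ t) s g ∧ (Pmat P π ^ t) s g ≤ 1 := by
  have h1 : ∀ s s', 0 ≤ Pmat P π s s' := fun s s' =>
    Finset.sum_nonneg fun a _ => mul_nonneg (hπ.1 s a) (hP.1 s a s')
  have h2 : ∀ s, ∑ s', Pmat P π s s' = 1 := by
    intro s
    unfold Pmat
    rw [Finset.sum_comm]
    simp_rw [← Finset.mul_sum, hP.2, mul_one]
    exact hπ.2 s
  refine ⟨h1, h2, ?_⟩
  intro t
  induction t with
  | zero =>
    intro s g
    rw [pow_zero, Matrix.one_apply]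
    split_ifs <;> norm_num
  | succ t ih =>
    intro s g
    rw [pow_succ', Matrix.mul_apply]
    refine ⟨Finset.sum_nonneg fun a _ => mul_nonneg (h1 s a) (ih a g).1, ?_⟩
    rw [← h2 s]
    exact Finset.sum_le_sum fun a _ => mul_le_of_le_one_right (h1 s a) (ih a g).2

lemma occC_le (γ : ℝ) (hγ0 : 0 < γ) (hγ1 : γ < 1)
    (P : S → A → S → ℝ) (hP : IsDynamics P) (π : S → A → ℝ) (hπ : IsPolicy π) (s g : S) :
    0 ≤ occC γ P π g g ∧ occC γ P π s g ≤ occC γ P π g g := by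
  obtain ⟨h1, h2, h3⟩ := Pmat_pow_aux P hP π hπ
  unfold occC
  set M := Pmat P π with hM
  have hsum : ∀ s, Summable fun t : ℕ => γ ^ t * (M ^ t) s g := fun s =>
    Summable.of_nonneg_of_le (fun t => mul_nonneg (by positivity) (h3 t s g).1)
      (fun t => mul_le_of_le_one_right (by positivity) (h3 t s g).2)
      (summable_geometric_of_lt_one hγ0.le hγ1)
  obtain ⟨V, hV⟩ : ∃ V : S → ℝ, ∀ s, V s = ∑' t : ℕ, γ ^ t * (M ^ t) s g := ⟨_, fun _ => rfl⟩
  have hnn : ∀ s, 0 ≤ V s := fun s => by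
    rw [hV]
    exact tsum_nonneg fun t => mul_nonneg (by positivity) (h3 t s g).1
  have hrec : ∀ s, s ≠ g → V s = γ * ∑ s', M s s' * V s' := by
    intro s hs
    rw [hV, (hsum s).tsum_eq_zero_add]
    have : ∀ t : ℕ, γ ^ (t + 1) * (M ^ (t + 1)) s g
        = ∑ s', γ * M s s' * (γ ^ t * (M ^ t) s' g) := by
      intro t
      rw [pow_succ' M, Matrix.mul_apply, Finset.mul_sum]
      exact Finset.sum_congr rfl fun x _ => by ring
    simp_rw [this]
    rw [Summable.tsum_finsetSum (fun i _ => (hsum i).mul_left _)]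
    simp_rw [tsum_mul_left, ← hV]
    rw [Finset.mul_sum]
    simp [Matrix.one_apply, hs, mul_assoc]
  have key : V s ≤ V g := by
    obtain ⟨m, hm⟩ := Finite.exists_max V
    by_cases hmg : m = g
    · exact hmg ▸ hm s
    · have hb : ∑ s', M m s' * V s' ≤ V m := by
        calc ∑ s', M m s' * V s' ≤ ∑ s', M m s' * V m :=
              Finset.sum_le_sum fun x _ => mul_le_mul_of_nonneg_left (hm x) (h1 m x)
          _ = V m := by rw [← Finset.sum_mul, h2, one_mul]
      have := hrec m hmg
      have h5 : V m ≤ 0 := by nlinarith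
      exact ((hm s).trans h5).trans (hnn g)
  rw [← hV, ← hV]
  have : 0 ≤ 1 - γ := by linarith
  exact ⟨mul_nonneg this (hnn g), mul_le_mul_of_nonneg_left key this⟩

/-- Positivity of the successor distance: `D s g ≤ 1`. -/
theorem Dval_le_one (γ : ℝ) (hγ0 : 0 < γ) (hγ1 : γ < 1)
    (P : S → A → S → ℝ) (hP : IsDynamics P) (s g : S) :
    Dval γ P s g ≤ 1 := by
  unfold Dval
  refine Real.iSup_le (fun π => ?_) zero_le_one
  have h := occC_le γ hγ0 hγ1 P hP π.1 π.2 s g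
  exact div_le_one_of_le₀ h.2 h.1
end

section
/- Consider a controlled Markov process with finite nonempty state space S, finite nonempty action space A, row-stochastic dynamics P : S → A → S → ℝ, and discount γ ∈ (0,1). Define D s g = ⨆_{π ∈ Π} occ γ π s g / occ γ π g g. Then D s s = 1 for every s ∈ S, and D s g ≤ γ < 1 whenever s ≠ g. (Identity part of the paper's Theorem 4.6: the successor distance d_SD(s,g) = −log D s g is zero if and only if s = g.) -/
open scoped BigOperators

variable {S A : Type*} [Fintype S] [DecidableEq S] [Nonempty S]
  [Fintype A] [DecidableEq A] [Nonempty A]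

lemma aux_bounds {n : Type*} [Fintype n] [DecidableEq n] (M : Matrix n n ℝ)
    (h0 : ∀ i j, 0 ≤ M i j) (h1 : ∀ i, ∑ j, M i j = 1) (t : ℕ) :
    ∀ i g, 0 ≤ (M ^ t) i g ∧ (M ^ t) i g ≤ 1 := by
  induction t with
  | zero =>
    intro i g
    rw [pow_zero, Matrix.one_apply]
    split_ifs <;> norm_num
  | succ k ih =>
    intro i g
    rw [pow_succ', Matrix.mul_apply]
    refine ⟨Finset.sum_nonneg fun j _ => mul_nonneg (h0 i j) (ih j g).1, ?_⟩
    rw [← h1 i]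
    exact Finset.sum_le_sum fun j _ => mul_le_of_le_one_right (h0 i j) (ih j g).2

lemma aux_summable_s10 {n : Type*} [Fintype n] [DecidableEq n] (M : Matrix n n ℝ)
    (h0 : ∀ i j, 0 ≤ M i j) (h1 : ∀ i, ∑ j, M i j = 1) (γ : ℝ) (hγ0 : 0 < γ) (hγ1 : γ < 1)
    (i g : n) : Summable fun t : ℕ => γ ^ t * (M ^ t) i g := by
  refine Summable.of_nonneg_of_le
    (fun t => mul_nonneg (by positivity) (aux_bounds M h0 h1 t i g).1)
    (fun t => mul_le_of_le_one_right (by positivity) (aux_bounds M h0 h1 t i g).2)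
    (summable_geometric_of_lt_one hγ0.le hγ1)

lemma aux_bellman {n : Type*} [Fintype n] [DecidableEq n] (M : Matrix n n ℝ)
    (h0 : ∀ i j, 0 ≤ M i j) (h1 : ∀ i, ∑ j, M i j = 1) (γ : ℝ) (hγ0 : 0 < γ) (hγ1 : γ < 1)
    (i g : n) : ∑' t : ℕ, γ ^ t * (M ^ t) i g =
      (if i = g then 1 else 0) + γ * ∑ j, M i j * ∑' t : ℕ, γ ^ t * (M ^ t) j g := by
  have hs := aux_summable_s10 M h0 h1 γ hγ0 hγ1
  rw [(hs i g).tsum_eq_zero_add]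
  congr 1
  · simp [Matrix.one_apply]
  · simp_rw [← tsum_mul_left]
    rw [← Summable.tsum_finsetSum (fun j _ => (hs j g).mul_left _), ← tsum_mul_left]
    congr 1
    ext t
    rw [pow_succ' M, Matrix.mul_apply, Finset.mul_sum, Finset.mul_sum]
    refine Finset.sum_congr rfl fun j _ => ?_
    ring

lemma aux_main {n : Type*} [Fintype n] [DecidableEq n] (M : Matrix n n ℝ)
    (h0 : ∀ i j, 0 ≤ M i j) (h1 : ∀ i, ∑ j, M i j = 1) (γ : ℝ) (hγ0 : 0 < γ) (hγ1 : γ < 1)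
    (g : n) : 0 < ∑' t : ℕ, γ ^ t * (M ^ t) g g ∧ ∀ i, i ≠ g →
      ∑' t : ℕ, γ ^ t * (M ^ t) i g ≤ γ * ∑' t : ℕ, γ ^ t * (M ^ t) g g := by
  have hb := fun i => aux_bellman M h0 h1 γ hγ0 hγ1 i g
  have hn : ∀ i, 0 ≤ ∑' t : ℕ, γ ^ t * (M ^ t) i g := fun i =>
    tsum_nonneg fun t => mul_nonneg (by positivity) (aux_bounds M h0 h1 t i g).1
  generalize hV : (fun i => ∑' t : ℕ, γ ^ t * (M ^ t) i g) = V at *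
  have hV' : ∀ i, ∑' t : ℕ, γ ^ t * (M ^ t) i g = V i := fun i => congrFun hV i
  simp only [hV'] at *
  have hg : 0 < V g := by
    rw [hb g, if_pos rfl]
    have := Finset.sum_nonneg fun j (_ : j ∈ Finset.univ) => mul_nonneg (h0 g j) (hn j)
    positivity
  refine ⟨hg, ?_⟩
  haveI : Nonempty n := ⟨g⟩
  obtain ⟨m, hm⟩ := Finite.exists_max V
  have key : ∀ i, i ≠ g → V i ≤ γ * V m := by
    intro i hi
    rw [hb i, if_neg hi, zero_add]
    refine mul_le_mul_of_nonneg_left ?_ hγ0.le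
    calc ∑ j, M i j * V j ≤ ∑ j, M i j * V m :=
          Finset.sum_le_sum fun j _ => mul_le_mul_of_nonneg_left (hm j) (h0 i j)
      _ = V m := by rw [← Finset.sum_mul, h1, one_mul]
  have hmg : m = g := by
    by_contra h
    have h2 := key m h
    have h3 := hm g
    nlinarith
  rwa [hmg] at key

/-- Identity property of the successor distance: `D s s = 1`, and `D s g ≤ γ < 1`
for `s ≠ g`. -/
theorem Dval_identity (γ : ℝ) (hγ0 : 0 < γ) (hγ1 : γ < 1)
    (P : S → A → S → ℝ) (hP : IsDynamics P) :
    (∀ s : S, Dval γ P s s = 1) ∧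
      (∀ s g : S, s ≠ g → Dval γ P s g ≤ γ) := by
  have hM0 : ∀ π : Pol S A, ∀ i j, 0 ≤ Pmat P π.1 i j := fun π i j =>
    Finset.sum_nonneg fun a _ => mul_nonneg (π.2.1 i a) (hP.1 i a j)
  have hM1 : ∀ π : Pol S A, ∀ i, ∑ j, Pmat P π.1 i j = 1 := by
    intro π i
    unfold Pmat
    rw [Finset.sum_comm]
    simp_rw [← Finset.mul_sum, hP.2, mul_one]
    exact π.2.2 i
  have hmain := fun (π : Pol S A) g => aux_main (Pmat P π.1) (hM0 π) (hM1 π) γ hγ0 hγ1 g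
  have hpos : ∀ (π : Pol S A) g, 0 < occC γ P π.1 g g := fun π g =>
    mul_pos (by linarith) (hmain π g).1
  haveI : Nonempty (Pol S A) := by
    classical
    obtain ⟨a0⟩ := ‹Nonempty A›
    exact ⟨⟨fun _ a => if a = a0 then 1 else 0,
      fun _ a => by dsimp only; split_ifs <;> norm_num, fun _ => by simp⟩⟩
  refine ⟨fun s => ?_, fun s g hsg => ?_⟩
  · unfold Dval
    simp_rw [fun π : Pol S A => div_self (hpos π s).ne']
    exact ciSup_const
  · refine ciSup_le fun π => ?_
    rw [div_le_iff₀ (hpos π g)]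
    have h := mul_le_mul_of_nonneg_left ((hmain π g).2 s hsg) (by linarith : (0:ℝ) ≤ 1 - γ)
    unfold occC
    linarith
end

section
/- Consider a controlled Markov process with finite nonempty state space S, finite nonempty action space A, row-stochastic dynamics P : S → A → S → ℝ, and discount γ ∈ (0,1). Define D s g = ⨆_{π ∈ Π} occ γ π s g / occ γ π g g. Then for all s, w, g ∈ S, the multiplicative triangle inequality holds: D s g ≥ D s w · D w g. (Triangle-inequality part of the paper's Theorem 4.6: the successor distance d_SD(s,g) = −log D s g satisfies d_SD(s,g) ≤ d_SD(s,w) + d_SD(w,g).) -/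
open scoped BigOperators

variable {S A : Type*} [Fintype S] [DecidableEq S] [Nonempty S]
  [Fintype A] [DecidableEq A] [Nonempty A]

section aux

theorem aux_max {S : Type*} [Fintype S] [Nonempty S] (γ : ℝ) (hγ0 : 0 < γ) (hγ1 : γ < 1)
    (M : S → S → ℝ) (h0 : ∀ s s', 0 ≤ M s s') (h1 : ∀ s, ∑ s', M s s' = 1)
    (u : S → ℝ) (hu : ∀ s, u s ≤ 0 ∨ u s ≤ γ * ∑ s', M s s' * u s') (s : S) : u s ≤ 0 := by
  obtain ⟨m, hm⟩ := Finite.exists_max u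
  refine (hm s).trans ?_
  rcases hu m with h | h
  · exact h
  · have : ∑ s', M m s' * u s' ≤ u m := by
      calc ∑ s', M m s' * u s' ≤ ∑ s', M m s' * u m :=
            Finset.sum_le_sum fun i _ => mul_le_mul_of_nonneg_left (hm i) (h0 m i)
        _ = u m := by rw [← Finset.sum_mul, h1, one_mul]
    nlinarith

theorem aux_pow {S : Type*} [Fintype S] [DecidableEq S]
    (M : Matrix S S ℝ) (h0 : ∀ s s', 0 ≤ M s s') (h1 : ∀ s, ∑ s', M s s' = 1) (t : ℕ) :
    ∀ s g, 0 ≤ (M ^ t) s g ∧ (M ^ t) s g ≤ 1 := by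
  induction t with
  | zero =>
    intro s g
    rw [pow_zero, Matrix.one_apply]
    split_ifs <;> norm_num
  | succ t ih =>
    intro s g
    rw [pow_succ', Matrix.mul_apply]
    refine ⟨Finset.sum_nonneg fun i _ => mul_nonneg (h0 s i) (ih i g).1, ?_⟩
    rw [← h1 s]
    exact Finset.sum_le_sum fun i _ => mul_le_of_le_one_right (h0 s i) (ih i g).2

theorem aux_sum {S : Type*} [Fintype S] [DecidableEq S] (γ : ℝ) (hγ0 : 0 < γ) (hγ1 : γ < 1)
    (M : Matrix S S ℝ) (h0 : ∀ s s', 0 ≤ M s s') (h1 : ∀ s, ∑ s', M s s' = 1) (s g : S) :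
    Summable fun t : ℕ => γ ^ t * (M ^ t) s g := by
  refine Summable.of_nonneg_of_le (fun t => mul_nonneg (by positivity) (aux_pow M h0 h1 t s g).1)
    (fun t => mul_le_of_le_one_right (by positivity) (aux_pow M h0 h1 t s g).2)
    (summable_geometric_of_lt_one hγ0.le hγ1)

theorem aux_rec {S : Type*} [Fintype S] [DecidableEq S] (γ : ℝ) (hγ0 : 0 < γ) (hγ1 : γ < 1)
    (M : Matrix S S ℝ) (h0 : ∀ s s', 0 ≤ M s s') (h1 : ∀ s, ∑ s', M s s' = 1) (s g : S) :
    ∑' t : ℕ, γ ^ t * (M ^ t) s g = (if s = g then 1 else 0) +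
      γ * ∑ s', M s s' * ∑' t : ℕ, γ ^ t * (M ^ t) s' g := by
  rw [(aux_sum γ hγ0 hγ1 M h0 h1 s g).tsum_eq_zero_add]
  congr 1
  · simp [Matrix.one_apply]
  · simp_rw [← tsum_mul_left]
    rw [← Summable.tsum_finsetSum
      (fun i _ => (aux_sum γ hγ0 hγ1 M h0 h1 i g).mul_left _), ← tsum_mul_left]
    refine tsum_congr fun t => ?_
    rw [pow_succ' M, Matrix.mul_apply, Finset.mul_sum, Finset.mul_sum]
    refine Finset.sum_congr rfl fun i _ => ?_
    ring

theorem aux_Pmat {S A : Type*} [Fintype S] [Fintype A] (P : S → A → S → ℝ) (hP : IsDynamics P)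
    (π : S → A → ℝ) (hπ : IsPolicy π) :
    (∀ s s', 0 ≤ Pmat P π s s') ∧ ∀ s, ∑ s', Pmat P π s s' = 1 := by
  refine ⟨fun s s' => Finset.sum_nonneg fun a _ => mul_nonneg (hπ.1 s a) (hP.1 s a s'), fun s => ?_⟩
  unfold Pmat
  rw [Finset.sum_comm]
  simp_rw [← Finset.mul_sum, hP.2, mul_one, hπ.2]

theorem aux_h {S A : Type*} [Fintype S] [DecidableEq S] [Nonempty S] [Fintype A]
    (γ : ℝ) (hγ0 : 0 < γ) (hγ1 : γ < 1)
    (P : S → A → S → ℝ) (hP : IsDynamics P) (π : S → A → ℝ) (hπ : IsPolicy π) (g : S) :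
    occC γ P π g g / occC γ P π g g = 1 ∧
    ∀ s, s ≠ g → occC γ P π s g / occC γ P π g g =
      γ * ∑ s', Pmat P π s s' * (occC γ P π s' g / occC γ P π g g) := by
  obtain ⟨h0, h1⟩ := aux_Pmat P hP π hπ
  have hr := fun s => aux_rec γ hγ0 hγ1 (Pmat P π) h0 h1 s g
  have hN : ∀ s, 0 ≤ ∑' t : ℕ, γ ^ t * (Pmat P π ^ t) s g := fun s =>
    tsum_nonneg fun t => mul_nonneg (by positivity) (aux_pow _ h0 h1 t s g).1
  have hpos : 0 < occC γ P π g g := by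
    unfold occC
    refine mul_pos (by linarith) ?_
    rw [hr g, if_pos rfl]
    have : 0 ≤ ∑ s', Pmat P π g s' * ∑' t : ℕ, γ ^ t * (Pmat P π ^ t) s' g :=
      Finset.sum_nonneg fun i _ => mul_nonneg (h0 g i) (hN i)
    positivity
  refine ⟨div_self hpos.ne', fun s hs => ?_⟩
  rw [div_eq_iff hpos.ne', mul_assoc, Finset.sum_mul]
  have : ∀ i, Pmat P π s i * (occC γ P π i g / occC γ P π g g) * occC γ P π g g
      = Pmat P π s i * occC γ P π i g := fun i => by field_simp
  simp_rw [this]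
  unfold occC
  rw [hr s, if_neg hs, zero_add, Finset.mul_sum, Finset.mul_sum, Finset.mul_sum]
  refine Finset.sum_congr rfl fun i _ => ?_
  ring

theorem aux_V {S A : Type*} [Fintype S] [DecidableEq S] [Nonempty S] [Fintype A] [Nonempty A]
    (γ : ℝ) (hγ0 : 0 < γ) (hγ1 : γ < 1)
    (P : S → A → S → ℝ) (hP : IsDynamics P) (g : S) :
    ∃ V : S → ℝ, V g = 1 ∧ ∀ s, s ≠ g → (∀ a, γ * ∑ s', P s a s' * V s' ≤ V s) ∧
      ∃ a, V s = γ * ∑ s', P s a s' * V s' := by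
  let Q : (S → ℝ) → S → A → ℝ := fun V s a => γ * ∑ s', P s a s' * V s'
  let T : (S → ℝ) → (S → ℝ) := fun V s =>
    if s = g then 1 else Finset.univ.sup' Finset.univ_nonempty (Q V s)
  have hQ : ∀ V W s a, Q V s a ≤ Q W s a + γ * dist V W := by
    intro V W s a
    have : ∑ s', P s a s' * V s' ≤ ∑ s', P s a s' * W s' + dist V W := by
      calc ∑ s', P s a s' * V s' ≤ ∑ s', P s a s' * (W s' + dist V W) := by
            refine Finset.sum_le_sum fun i _ => mul_le_mul_of_nonneg_left ?_ (hP.1 s a i)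
            have := dist_le_pi_dist V W i
            rw [Real.dist_eq] at this
            linarith [le_abs_self (V i - W i)]
        _ = _ := by simp_rw [mul_add, Finset.sum_add_distrib, ← Finset.sum_mul, hP.2, one_mul]
    have := mul_le_mul_of_nonneg_left this hγ0.le
    simp only [Q]
    linarith
  have hT : ∀ V W s, T V s ≤ T W s + γ * dist V W := by
    intro V W s
    by_cases hs : s = g
    · simp only [T, if_pos hs]
      have : 0 ≤ γ * dist V W := by positivity
      linarith
    · simp only [T, if_neg hs]
      refine Finset.sup'_le _ _ fun a ha => (hQ V W s a).trans ?_
      have := Finset.le_sup' (Q W s) ha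
      linarith
  have hc : ContractingWith ⟨γ, hγ0.le⟩ T := by
    refine ⟨by exact_mod_cast hγ1, LipschitzWith.of_dist_le_mul fun V W => ?_⟩
    change dist (T V) (T W) ≤ γ * dist V W
    refine (dist_pi_le_iff (by positivity)).2 fun s => ?_
    rw [Real.dist_eq, abs_le]
    have h1 := hT V W s
    have h2 := hT W V s
    rw [dist_comm W V] at h2
    constructor <;> linarith
  have hfix : T (hc.fixedPoint T) = hc.fixedPoint T := hc.fixedPoint_isFixedPt
  generalize hc.fixedPoint T = V at hfix
  refine ⟨V, ?_, fun s hs => ?_⟩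
  · rw [← hfix]; simp [T]
  · have hV : V s = Finset.univ.sup' Finset.univ_nonempty (Q V s) := by
      conv_lhs => rw [← hfix]
      simp only [T, if_neg hs]
    refine ⟨fun a => ?_, ?_⟩
    · rw [hV]; exact Finset.le_sup' (Q V s) (Finset.mem_univ a)
    · obtain ⟨a, _, ha⟩ := Finset.exists_mem_eq_sup' Finset.univ_nonempty (Q V s)
      exact ⟨a, hV.trans ha⟩

theorem aux_Psum {S A : Type*} [Fintype S] [Fintype A] (P : S → A → S → ℝ)
    (π : S → A → ℝ) (V : S → ℝ) (s : S) :
    ∑ s', Pmat P π s s' * V s' = ∑ a, π s a * ∑ s', P s a s' * V s' := by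
  unfold Pmat
  simp_rw [Finset.sum_mul, Finset.mul_sum]
  rw [Finset.sum_comm]
  simp_rw [mul_assoc]

theorem aux_le {S A : Type*} [Fintype S] [Fintype A]
    (γ : ℝ) (P : S → A → S → ℝ) (π : S → A → ℝ) (hπ : IsPolicy π) (V : S → ℝ) (s : S)
    (h : ∀ a, γ * ∑ s', P s a s' * V s' ≤ V s) :
    γ * ∑ s', Pmat P π s s' * V s' ≤ V s := by
  rw [aux_Psum, Finset.mul_sum]
  calc ∑ a, γ * (π s a * ∑ s', P s a s' * V s') = ∑ a, π s a * (γ * ∑ s', P s a s' * V s') :=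
        Finset.sum_congr rfl fun a _ => by ring
    _ ≤ ∑ a, π s a * V s :=
        Finset.sum_le_sum fun a _ => mul_le_mul_of_nonneg_left (h a) (hπ.1 s a)
    _ = V s := by rw [← Finset.sum_mul, hπ.2, one_mul]

theorem aux_D {S A : Type*} [Fintype S] [DecidableEq S] [Nonempty S] [Fintype A] [DecidableEq A]
    [Nonempty A] (γ : ℝ) (hγ0 : 0 < γ) (hγ1 : γ < 1)
    (P : S → A → S → ℝ) (hP : IsDynamics P) (g : S) :
    Dval γ P g g = 1 ∧ (∀ s, 0 ≤ Dval γ P s g ∧ Dval γ P s g ≤ 1) ∧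
    (∀ s, s ≠ g → ∀ a, γ * ∑ s', P s a s' * Dval γ P s' g ≤ Dval γ P s g) ∧
    ∃ π : S → A → ℝ, IsPolicy π ∧ ∀ s, s ≠ g →
      Dval γ P s g = γ * ∑ s', Pmat P π s s' * Dval γ P s' g := by
  obtain ⟨V, hVg, hV⟩ := aux_V γ hγ0 hγ1 P hP g
  have hch : ∀ s, ∃ a, s ≠ g → V s = γ * ∑ s', P s a s' * V s' := by
    intro s
    by_cases hs : s = g
    · exact ⟨Classical.arbitrary A, fun h => absurd hs h⟩
    · obtain ⟨a, ha⟩ := (hV s hs).2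
      exact ⟨a, fun _ => ha⟩
  choose f hf using hch
  let π : S → A → ℝ := fun s a => if a = f s then 1 else 0
  have hπ : IsPolicy π := by
    refine ⟨fun s a => ?_, fun s => by simp [π]⟩
    simp only [π]; split_ifs <;> norm_num
  have hVπ : ∀ s, s ≠ g → V s = γ * ∑ s', Pmat P π s s' * V s' := by
    intro s hs
    rw [aux_Psum]
    simpa [π] using hf s hs
  -- every policy value is at most V
  have hle : ∀ ρ : Pol S A, ∀ s, occC γ P ρ.1 s g / occC γ P ρ.1 g g ≤ V s := by
    intro ρ s
    obtain ⟨m0, m1⟩ := aux_Pmat P hP ρ.1 ρ.2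
    obtain ⟨e1, e2⟩ := aux_h γ hγ0 hγ1 P hP ρ.1 ρ.2 g
    have := aux_max γ hγ0 hγ1 _ m0 m1
      (fun s => occC γ P ρ.1 s g / occC γ P ρ.1 g g - V s) (fun s => ?_) s
    · simpa using this
    · by_cases hs : s = g
      · left; subst hs; rw [e1, hVg]; norm_num
      · right
        have := aux_le γ P ρ.1 ρ.2 V s (hV s hs).1
        simp_rw [mul_sub, Finset.sum_sub_distrib, mul_sub]
        rw [← e2 s hs]
        linarith
  obtain ⟨m0, m1⟩ := aux_Pmat P hP π hπ
  obtain ⟨e1, e2⟩ := aux_h γ hγ0 hγ1 P hP π hπ g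
  have hge : ∀ s, V s ≤ occC γ P π s g / occC γ P π g g := by
    intro s
    have := aux_max γ hγ0 hγ1 _ m0 m1
      (fun s => V s - occC γ P π s g / occC γ P π g g) (fun s => ?_) s
    · simpa using this
    · by_cases hs : s = g
      · left; subst hs; rw [e1, hVg]; norm_num
      · right
        simp_rw [mul_sub, Finset.sum_sub_distrib, mul_sub]
        rw [← e2 s hs, ← hVπ s hs]
  have hD : ∀ s, Dval γ P s g = V s := by
    intro s
    haveI : Nonempty (Pol S A) := ⟨⟨π, hπ⟩⟩
    refine le_antisymm (ciSup_le fun ρ => hle ρ s) ((hge s).trans ?_)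
    exact le_ciSup (f := fun ρ : Pol S A => occC γ P ρ.1 s g / occC γ P ρ.1 g g)
      ⟨V s, by rintro _ ⟨ρ, rfl⟩; exact hle ρ s⟩ ⟨π, hπ⟩
  have hV0 : ∀ s, 0 ≤ V s := by
    intro s
    have := aux_max γ hγ0 hγ1 _ m0 m1 (fun s => - V s) (fun s => ?_) s
    · simpa using this
    · by_cases hs : s = g
      · left; subst hs; rw [hVg]; norm_num
      · right
        simp_rw [mul_neg, Finset.sum_neg_distrib, mul_neg]
        rw [← hVπ s hs]
  have hV1 : ∀ s, V s ≤ 1 := by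
    intro s
    have := aux_max γ hγ0 hγ1 _ m0 m1 (fun s => V s - 1) (fun s => ?_) s
    · simpa using this
    · by_cases hs : s = g
      · left; subst hs; rw [hVg]; norm_num
      · right
        simp_rw [mul_sub, Finset.sum_sub_distrib, mul_sub, mul_one, m1]
        rw [← hVπ s hs]
        linarith
  simp_rw [hD]
  exact ⟨hVg, fun s => ⟨hV0 s, hV1 s⟩, fun s hs => (hV s hs).1, π, hπ, hVπ⟩

end aux

/-- Multiplicative triangle inequality for the successor value. -/
theorem Dval_triangle (γ : ℝ) (hγ0 : 0 < γ) (hγ1 : γ < 1)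
    (P : S → A → S → ℝ) (hP : IsDynamics P) (s w g : S) :
    Dval γ P s g ≥ Dval γ P s w * Dval γ P w g := by
  obtain ⟨hg1, hgb, hgs, -⟩ := aux_D γ hγ0 hγ1 P hP g
  obtain ⟨hw1, hwb, -, π, hπ, hwe⟩ := aux_D γ hγ0 hγ1 P hP w
  obtain ⟨m0, m1⟩ := aux_Pmat P hP π hπ
  have := aux_max γ hγ0 hγ1 _ m0 m1
    (fun s => Dval γ P s w * Dval γ P w g - Dval γ P s g) (fun s => ?_) s
  · simpa using this
  · by_cases hs : s = w
    · left; subst hs; rw [hw1]; linarith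
    by_cases hs' : s = g
    · left; subst hs'; rw [hg1]
      linarith [mul_le_one₀ (hwb s).2 (hgb w).1 (hgb w).2]
    · right
      have h := aux_le γ P π hπ (fun s => Dval γ P s g) s (hgs s hs')
      simp_rw [mul_sub, Finset.sum_sub_distrib, mul_sub, ← mul_assoc]
      rw [← Finset.sum_mul, ← mul_assoc, ← hwe s hs]
      linarith
end

section
/- Consider a controlled Markov process with finite nonempty state space S, finite nonempty action space A, row-stochastic dynamics P : S → A → S → ℝ, discount γ ∈ (0,1), and a stationary stochastic policy π ∈ Π. Then for all s, g ∈ S with s ≠ g and all a, a' ∈ A, the Laplace transform of the first-passage time of the pair (g,a') decomposes at the first visit to the state g: L γ Q_π (s,a) (g,a') = LS γ π (s,a) g · (Σ_{â ∈ A} π g â · L γ Q_π (g,â) (g,a')), where LS γ π (s,a) g = Σ_{h=0}^∞ γ^h · fS h (s,a) g is the Laplace transform of the first time the state component of the Q_π-chain equals g. (Laplace-transform form of the paper's Remark B.5: H_{s,a}(g,a') = H_{s,a}(g) + H_{g,Â}(g,a') with Â ∼ π(·|g).) -/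
open scoped BigOperators

variable {S A : Type*} [Fintype S] [DecidableEq S] [Nonempty S]
  [Fintype A] [DecidableEq A] [Nonempty A]

/-- State-action transition matrix on `S × A` induced by policy `π`. -/
noncomputable def Qmat (P : S → A → S → ℝ) (π : S → A → ℝ) :
    Matrix (S × A) (S × A) ℝ :=
  fun x y => P x.1 x.2 y.1 * π y.1 y.2

/-- Discounted state-action occupancy measure under policy `π`. -/
noncomputable def occSA (γ : ℝ) (P : S → A → S → ℝ) (π : S → A → ℝ)
    (x y : S × A) : ℝ :=
  (1 - γ) * ∑' t : ℕ, γ ^ t * ((Qmat P π) ^ t) x y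

/-- First-passage probabilities of the state component of the `Qmat`-chain. -/
noncomputable def fS (P : S → A → S → ℝ) (π : S → A → ℝ) :
    ℕ → S × A → S → ℝ
  | 0, x, g => if x.1 = g then 1 else 0
  | h + 1, x, g => if x.1 = g then 0 else ∑ y : S × A, Qmat P π x y * fS P π h y g

/-- Laplace transform of the first time the state component of the chain hits `g`. -/
noncomputable def LS (γ : ℝ) (P : S → A → S → ℝ) (π : S → A → ℝ)
    (x : S × A) (g : S) : ℝ :=
  ∑' h : ℕ, γ ^ h * fS P π h x g

theorem aux_rec_s14 {X : Type*} [Fintype X] (γ : ℝ) (hγ0 : 0 < γ) (hγ1 : γ < 1)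
    (M : Matrix X X ℝ) (f : ℕ → X → ℝ) (hf : ∀ h x, 0 ≤ f h x ∧ f h x ≤ 1) (x : X)
    (h0 : f 0 x = 0) (hs : ∀ h, f (h + 1) x = ∑ y, M x y * f h y) :
    ∑' h : ℕ, γ ^ h * f h x = γ * ∑ y, M x y * ∑' h : ℕ, γ ^ h * f h y := by
  have hsum : ∀ y, Summable (fun h : ℕ => γ ^ h * f h y) := fun y =>
    Summable.of_nonneg_of_le (fun h => mul_nonneg (pow_nonneg hγ0.le h) (hf h y).1)
      (fun h => mul_le_of_le_one_right (pow_nonneg hγ0.le h) (hf h y).2)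
      (summable_geometric_of_lt_one hγ0.le hγ1)
  rw [(hsum x).tsum_eq_zero_add, h0, mul_zero, zero_add]
  have h1 : ∀ h : ℕ, γ ^ (h + 1) * f (h + 1) x = γ * ∑ y, M x y * (γ ^ h * f h y) := by
    intro h
    rw [hs, pow_succ, Finset.mul_sum, Finset.mul_sum]
    exact Finset.sum_congr rfl fun y _ => by ring
  simp_rw [h1]
  rw [tsum_mul_left, Summable.tsum_finsetSum (fun y _ => (hsum y).mul_left _)]
  simp_rw [tsum_mul_left]

theorem aux_bd {X : Type*} [Fintype X] (M : Matrix X X ℝ) (hM : ∀ x y, 0 ≤ M x y)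
    (hM1 : ∀ x, ∑ y, M x y = 1) (f : X → ℝ) (hf : ∀ x, 0 ≤ f x ∧ f x ≤ 1) (x : X) :
    0 ≤ ∑ y, M x y * f y ∧ ∑ y, M x y * f y ≤ 1 := by
  refine ⟨Finset.sum_nonneg fun y _ => mul_nonneg (hM x y) (hf y).1, ?_⟩
  rw [← hM1 x]
  exact Finset.sum_le_sum fun y _ => mul_le_of_le_one_right (hM x y) (hf y).2

theorem aux_uniq {X : Type*} [Fintype X] [Nonempty X] (γ : ℝ) (hγ0 : 0 < γ) (hγ1 : γ < 1)
    (M : Matrix X X ℝ) (hM : ∀ x y, 0 ≤ M x y) (hM1 : ∀ x, ∑ y, M x y = 1) (E : X → ℝ)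
    (hE : ∀ x, E x = 0 ∨ E x = γ * ∑ y, M x y * E y) (x : X) : E x = 0 := by
  obtain ⟨z, hz⟩ := Finite.exists_max (fun x => |E x|)
  have hz0 : |E z| = 0 := by
    rcases hE z with h | h
    · simp [h]
    · have h1 : |∑ y, M z y * E y| ≤ |E z| := by
        calc |∑ y, M z y * E y| ≤ ∑ y, |M z y * E y| := Finset.abs_sum_le_sum_abs _ _
          _ ≤ ∑ y, M z y * |E z| := Finset.sum_le_sum fun y _ => by
              rw [abs_mul, abs_of_nonneg (hM z y)]
              exact mul_le_mul_of_nonneg_left (hz y) (hM z y)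
          _ = |E z| := by rw [← Finset.sum_mul, hM1, one_mul]
      have h2 : |E z| = γ * |∑ y, M z y * E y| := by
        conv_lhs => rw [h, abs_mul, abs_of_pos hγ0]
      have := abs_nonneg (E z)
      nlinarith
  exact abs_eq_zero.mp (le_antisymm (hz0 ▸ hz x) (abs_nonneg _))

/-- The Laplace transform of the first-passage time of `(g, a')` decomposes at
the first visit to the state `g` (Remark B.5). -/
theorem Lhit_decompose_at_goal (γ : ℝ) (hγ0 : 0 < γ) (hγ1 : γ < 1)
    (P : S → A → S → ℝ) (hP : IsDynamics P)
    (π : S → A → ℝ) (hπ : IsPolicy π)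
    (s g : S) (hsg : s ≠ g) (a a' : A) :
    Lhit γ (Qmat P π) (s, a) (g, a') =
      LS γ P π (s, a) g * ∑ ahat : A, π g ahat * Lhit γ (Qmat P π) (g, ahat) (g, a') := by
  have hM : ∀ x y, 0 ≤ Qmat P π x y := fun x y => mul_nonneg (hP.1 _ _ _) (hπ.1 _ _)
  have hM1 : ∀ x, ∑ y, Qmat P π x y = 1 := by
    intro x
    simp only [Qmat, Fintype.sum_prod_type]
    simp_rw [← Finset.mul_sum, hπ.2, mul_one, hP.2]
  have hfp : ∀ h x, 0 ≤ fp (Qmat P π) h x (g, a') ∧ fp (Qmat P π) h x (g, a') ≤ 1 := by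
    intro h
    induction h with
    | zero => intro x; simp only [fp]; split_ifs <;> norm_num
    | succ h ih =>
      intro x; simp only [fp]; split_ifs
      · norm_num
      · exact aux_bd _ hM hM1 _ ih x
  have hfS : ∀ h x, 0 ≤ fS P π h x g ∧ fS P π h x g ≤ 1 := by
    intro h
    induction h with
    | zero => intro x; simp only [fS]; split_ifs <;> norm_num
    | succ h ih =>
      intro x; simp only [fS]; split_ifs
      · norm_num
      · exact aux_bd _ hM hM1 _ ih x
  have hL : ∀ x : S × A, x.1 ≠ g → Lhit γ (Qmat P π) x (g, a') =
      γ * ∑ y, Qmat P π x y * Lhit γ (Qmat P π) y (g, a') := by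
    intro x hx
    have hx' : x ≠ (g, a') := fun h => hx (by rw [h])
    exact aux_rec_s14 γ hγ0 hγ1 _ (fun h x => fp (Qmat P π) h x (g, a')) hfp x
      (by simp [fp, hx']) (fun h => by simp [fp, hx'])
  have hLS : ∀ x : S × A, x.1 ≠ g → LS γ P π x g =
      γ * ∑ y, Qmat P π x y * LS γ P π y g := by
    intro x hx
    exact aux_rec_s14 γ hγ0 hγ1 _ (fun h x => fS P π h x g) hfS x
      (by simp [fS, hx]) (fun h => by simp [fS, hx])
  have hLS1 : ∀ b : A, LS γ P π (g, b) g = 1 := by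
    intro b
    unfold LS
    rw [tsum_eq_single 0]
    · simp [fS]
    · intro h hh
      obtain ⟨k, rfl⟩ := Nat.exists_eq_succ_of_ne_zero hh
      simp [fS]
  set C := ∑ ahat : A, π g ahat * Lhit γ (Qmat P π) (g, ahat) (g, a') with hC
  set D : S × A → ℝ := fun x => Lhit γ (Qmat P π) x (g, a') - LS γ P π x g * C with hD
  have hg : ∑ b : A, π g b * D (g, b) = 0 := by
    simp only [hD, hLS1, one_mul, mul_sub, Finset.sum_sub_distrib]
    rw [← Finset.sum_mul, hπ.2, one_mul, ← hC, sub_self]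
  have key := aux_uniq γ hγ0 hγ1 (Qmat P π) hM hM1 (fun x => if x.1 = g then 0 else D x) (by
    intro x
    by_cases hx : x.1 = g
    · left; simp [hx]
    · right
      have e1 : D x = γ * ∑ y, Qmat P π x y * D y := by
        simp only [hD, mul_sub, Finset.sum_sub_distrib]
        rw [hL x hx, hLS x hx, mul_assoc, Finset.sum_mul]
        simp only [mul_assoc]
      simp only [hx, if_false]
      rw [e1]
      congr 1
      simp only [Fintype.sum_prod_type]
      refine Finset.sum_congr rfl fun t _ => ?_
      by_cases ht : t = g
      · subst ht
        simp only [Qmat, if_true, mul_zero, Finset.sum_const_zero, mul_assoc]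
        rw [← Finset.mul_sum, hg, mul_zero]
      · simp [ht]) (s, a)
  simp only [hsg, if_false, hD] at key
  linarith
end

section
/- Consider a controlled Markov process with finite nonempty state space S, finite nonempty action space A, row-stochastic dynamics P : S → A → S → ℝ, and discount γ ∈ (0,1). Then for all s, g ∈ S with s ≠ g and all a ∈ A, the quantity ⨆_{π ∈ Π} occSA γ π (s,a) (g,a') / occSA γ π (g,a') (g,a') is independent of the action a': for any a₁', a₂' ∈ A, ⨆_{π ∈ Π} occSA γ π (s,a) (g,a₁') / occSA γ π (g,a₁') (g,a₁') = ⨆_{π ∈ Π} occSA γ π (s,a) (g,a₂') / occSA γ π (g,a₂') (g,a₂'). (Paper's Lemma 4.4: the successor distance d_SD((s,a),(s',a')) is independent of a' when s ≠ s'.) -/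
open scoped BigOperators

variable {S A : Type*} [Fintype S] [DecidableEq S] [Nonempty S]
  [Fintype A] [DecidableEq A] [Nonempty A]

lemma Qmat_pow_props {P : S → A → S → ℝ} (hP : IsDynamics P) {π : S → A → ℝ} (hπ : IsPolicy π)
    (t : ℕ) : (∀ x y, 0 ≤ ((Qmat P π) ^ t) x y) ∧ ∀ x, ∑ y, ((Qmat P π) ^ t) x y = 1 := by
  induction t with
  | zero =>
    refine ⟨fun x y => ?_, fun x => ?_⟩
    · rw [pow_zero, Matrix.one_apply]; split_ifs <;> norm_num
    · simp [Matrix.one_apply]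
  | succ t ih =>
    have hQ : ∀ x, ∑ y, Qmat P π x y = 1 := by
      intro x
      rw [Fintype.sum_prod_type]
      simp only [Qmat, ← Finset.mul_sum, hπ.2, mul_one, hP.2]
    refine ⟨fun x y => ?_, fun x => ?_⟩
    · rw [pow_succ', Matrix.mul_apply]
      exact Finset.sum_nonneg fun z _ => mul_nonneg (mul_nonneg (hP.1 _ _ _) (hπ.1 _ _)) (ih.1 _ _)
    · simp only [pow_succ', Matrix.mul_apply]
      rw [Finset.sum_comm]
      simp only [← Finset.mul_sum, ih.2, mul_one, hQ]

lemma occ_summable {γ : ℝ} (hγ0 : 0 < γ) (hγ1 : γ < 1) {P : S → A → S → ℝ} (hP : IsDynamics P)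
    {π : S → A → ℝ} (hπ : IsPolicy π) (x y : S × A) :
    Summable fun t : ℕ => γ ^ t * ((Qmat P π) ^ t) x y := by
  refine Summable.of_nonneg_of_le (fun t => ?_) (fun t => ?_)
    (summable_geometric_of_lt_one hγ0.le hγ1)
  · exact mul_nonneg (pow_nonneg hγ0.le _) ((Qmat_pow_props hP hπ t).1 _ _)
  · refine mul_le_of_le_one_right (pow_nonneg hγ0.le _) ?_
    rw [← (Qmat_pow_props hP hπ t).2 x]
    exact Finset.single_le_sum (f := fun y => ((Qmat P π) ^ t) x y)
      (fun z _ => (Qmat_pow_props hP hπ t).1 x z) (Finset.mem_univ y)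

lemma occ_rec {γ : ℝ} (hγ0 : 0 < γ) (hγ1 : γ < 1) {P : S → A → S → ℝ} (hP : IsDynamics P)
    {π : S → A → ℝ} (hπ : IsPolicy π) (x y : S × A) :
    occSA γ P π x y = (1 - γ) * (if x = y then 1 else 0)
      + γ * ∑ z, Qmat P π x z * occSA γ P π z y := by
  have h1 : ∀ t : ℕ, γ ^ (t + 1) * ((Qmat P π) ^ (t + 1)) x y =
      ∑ z, γ * Qmat P π x z * (γ ^ t * ((Qmat P π) ^ t) z y) := by
    intro t
    rw [pow_succ' (Qmat P π), Matrix.mul_apply, Finset.mul_sum]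
    exact Finset.sum_congr rfl fun z _ => by ring
  unfold occSA
  rw [(occ_summable hγ0 hγ1 hP hπ x y).tsum_eq_zero_add]
  simp only [h1]
  rw [Summable.tsum_finsetSum (fun z _ => (occ_summable hγ0 hγ1 hP hπ z y).mul_left _)]
  simp only [tsum_mul_left, pow_zero, one_mul, Matrix.one_apply, mul_add, Finset.mul_sum]
  congr 1
  exact Finset.sum_congr rfl fun z _ => by ring

lemma occ_self_pos {γ : ℝ} (hγ0 : 0 < γ) (hγ1 : γ < 1) {P : S → A → S → ℝ} (hP : IsDynamics P)
    {π : S → A → ℝ} (hπ : IsPolicy π) (y : S × A) : 0 < occSA γ P π y y := by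
  have h0 : ∀ z, 0 ≤ occSA γ P π z y := fun z =>
    mul_nonneg (by linarith) (tsum_nonneg fun t =>
      mul_nonneg (pow_nonneg hγ0.le _) ((Qmat_pow_props hP hπ t).1 _ _))
  rw [occ_rec hγ0 hγ1 hP hπ, if_pos rfl]
  have : 0 ≤ γ * ∑ z, Qmat P π y z * occSA γ P π z y :=
    mul_nonneg hγ0.le (Finset.sum_nonneg fun z _ =>
      mul_nonneg (mul_nonneg (hP.1 _ _ _) (hπ.1 _ _)) (h0 z))
  linarith

/-- Hitting ratio. -/
noncomputable def hitR (γ : ℝ) (P : S → A → S → ℝ) (π : S → A → ℝ) (y x : S × A) : ℝ :=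
  occSA γ P π x y / occSA γ P π y y

/-- Averaged hitting ratio. -/
noncomputable def hitV (γ : ℝ) (P : S → A → S → ℝ) (π : S → A → ℝ) (y : S × A) (s : S) : ℝ :=
  ∑ a, π s a * hitR γ P π y (s, a)

lemma hitR_rec {γ : ℝ} (hγ0 : 0 < γ) (hγ1 : γ < 1) {P : S → A → S → ℝ} (hP : IsDynamics P)
    {π : S → A → ℝ} (hπ : IsPolicy π) (y : S × A) (s : S) (a : A) (h : (s, a) ≠ y) :
    hitR γ P π y (s, a) = γ * ∑ s', P s a s' * hitV γ P π y s' := by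
  unfold hitV hitR
  rw [occ_rec hγ0 hγ1 hP hπ, if_neg h, mul_zero, zero_add, mul_div_assoc, Finset.sum_div,
    Fintype.sum_prod_type]
  congr 1
  refine Finset.sum_congr rfl fun s' _ => ?_
  rw [Finset.mul_sum]
  refine Finset.sum_congr rfl fun z _ => ?_
  simp only [Qmat]
  ring

lemma avg_le {ι : Type*} [Fintype ι] {w f : ι → ℝ} (hw : ∀ i, 0 ≤ w i) (hs : ∑ i, w i = 1)
    {c : ℝ} (hf : ∀ i, f i ≤ c) : ∑ i, w i * f i ≤ c := by
  calc ∑ i, w i * f i ≤ ∑ i, w i * c :=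
        Finset.sum_le_sum fun i _ => mul_le_mul_of_nonneg_left (hf i) (hw i)
    _ = c := by rw [← Finset.sum_mul, hs, one_mul]

lemma hitR_self {γ : ℝ} (hγ0 : 0 < γ) (hγ1 : γ < 1) {P : S → A → S → ℝ} (hP : IsDynamics P)
    {π : S → A → ℝ} (hπ : IsPolicy π) (y : S × A) : hitR γ P π y y = 1 :=
  div_self (occ_self_pos hγ0 hγ1 hP hπ y).ne'

lemma hitR_le_one {γ : ℝ} (hγ0 : 0 < γ) (hγ1 : γ < 1) {P : S → A → S → ℝ} (hP : IsDynamics P)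
    {π : S → A → ℝ} (hπ : IsPolicy π) (y x : S × A) : hitR γ P π y x ≤ 1 := by
  haveI : Nonempty (S × A) := ⟨x⟩
  obtain ⟨m, hm⟩ := Finite.exists_max (hitR γ P π y)
  refine (hm x).trans ?_
  by_cases h : m = y
  · rw [h, hitR_self hγ0 hγ1 hP hπ]
  · have h1 := hitR_rec hγ0 hγ1 hP hπ y m.1 m.2 h
    have h2 : ∑ s', P m.1 m.2 s' * hitV γ P π y s' ≤ hitR γ P π y m :=
      avg_le (hP.1 _ _) (hP.2 _ _) fun s' => avg_le (hπ.1 _) (hπ.2 _) fun a => hm _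
    have h3 : hitR γ P π y m ≤ γ * hitR γ P π y m :=
      h1.le.trans (mul_le_mul_of_nonneg_left h2 hγ0.le)
    nlinarith

lemma exists_better {γ : ℝ} (hγ0 : 0 < γ) (hγ1 : γ < 1) {P : S → A → S → ℝ} (hP : IsDynamics P)
    {π : S → A → ℝ} (hπ : IsPolicy π) (s g : S) (hsg : s ≠ g) (a a₁ a₂ : A) :
    ∃ π' : S → A → ℝ, IsPolicy π' ∧
      hitR γ P π (g, a₁) (s, a) ≤ hitR γ P π' (g, a₂) (s, a) := by
  let π' : S → A → ℝ := fun s b => if s = g then (if b = a₂ then 1 else 0) else π s b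
  have hπ' : IsPolicy π' := by
    refine ⟨fun s b => ?_, fun s => ?_⟩
    · simp only [π']; split_ifs
      · norm_num
      · norm_num
      · exact hπ.1 _ _
    · by_cases h : s = g
      · simp [π', h]
      · simp [π', h, hπ.2]
  refine ⟨π', hπ', ?_⟩
  have key : ∀ (s : S) (b : A), s ≠ g → hitR γ P π (g, a₁) (s, b) - hitR γ P π' (g, a₂) (s, b) =
      γ * ∑ s', P s b s' * (hitV γ P π (g, a₁) s' - hitV γ P π' (g, a₂) s') := by
    intro s b h
    rw [hitR_rec hγ0 hγ1 hP hπ _ _ _ (by simp [h]), hitR_rec hγ0 hγ1 hP hπ' _ _ _ (by simp [h])]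
    simp only [mul_sub, Finset.sum_sub_distrib]
  haveI : Nonempty S := ⟨s⟩
  obtain ⟨m, hm⟩ := Finite.exists_max
    (fun s' => hitV γ P π (g, a₁) s' - hitV γ P π' (g, a₂) s')
  have hD : hitV γ P π (g, a₁) m - hitV γ P π' (g, a₂) m ≤ 0 := by
    by_cases h : m = g
    · have e1 : hitV γ P π (g, a₁) m ≤ 1 :=
        avg_le (hπ.1 _) (hπ.2 _) fun b => hitR_le_one hγ0 hγ1 hP hπ _ _
      have e2 : hitV γ P π' (g, a₂) m = 1 := by
        subst h
        simp [hitV, π', hitR_self hγ0 hγ1 hP hπ']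
      linarith
    · have e : hitV γ P π (g, a₁) m - hitV γ P π' (g, a₂) m =
          ∑ b, π m b * (hitR γ P π (g, a₁) (m, b) - hitR γ P π' (g, a₂) (m, b)) := by
        simp only [hitV, mul_sub, Finset.sum_sub_distrib]
        simp [π', h]
      have e2 : ∑ b, π m b * (hitR γ P π (g, a₁) (m, b) - hitR γ P π' (g, a₂) (m, b)) ≤
          γ * (hitV γ P π (g, a₁) m - hitV γ P π' (g, a₂) m) :=
        avg_le (hπ.1 _) (hπ.2 _) fun b => by
          rw [key m b h]
          exact mul_le_mul_of_nonneg_left (avg_le (hP.1 _ _) (hP.2 _ _) hm) hγ0.le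
      rw [← e] at e2
      nlinarith
  have := key s a hsg
  have h2 := avg_le (hP.1 s a) (hP.2 s a) fun s' => (hm s').trans hD
  have h3 := mul_nonpos_of_nonneg_of_nonpos hγ0.le h2
  linarith

lemma sup_le_aux {γ : ℝ} (hγ0 : 0 < γ) (hγ1 : γ < 1)
    {P : S → A → S → ℝ} (hP : IsDynamics P)
    (s g : S) (hsg : s ≠ g) (a : A) (a₁' a₂' : A) :
    (⨆ π : Pol S A, occSA γ P π.1 (s, a) (g, a₁') / occSA γ P π.1 (g, a₁') (g, a₁')) ≤
      ⨆ π : Pol S A, occSA γ P π.1 (s, a) (g, a₂') / occSA γ P π.1 (g, a₂') (g, a₂') := by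
  haveI : Nonempty (Pol S A) := by
    refine ⟨⟨fun _ b => if b = a then 1 else 0, fun s b => ?_, fun s => ?_⟩⟩
    · dsimp only; split_ifs <;> norm_num
    · simp
  refine ciSup_le fun π => ?_
  obtain ⟨π', hπ', h⟩ := exists_better hγ0 hγ1 hP π.2 s g hsg a a₁' a₂'
  refine le_trans h (le_ciSup (f := fun π : Pol S A =>
    occSA γ P π.1 (s, a) (g, a₂') / occSA γ P π.1 (g, a₂') (g, a₂')) ?_ ⟨π', hπ'⟩)
  refine ⟨1, ?_⟩
  rintro _ ⟨p, rfl⟩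
  exact hitR_le_one hγ0 hγ1 hP p.2 (g, a₂') (s, a)

/-- The successor value on state-action pairs is independent of the action at the
goal when `s ≠ g` (Lemma 4.4). -/
theorem sup_occSA_ratio_action_invariant (γ : ℝ) (hγ0 : 0 < γ) (hγ1 : γ < 1)
    (P : S → A → S → ℝ) (hP : IsDynamics P)
    (s g : S) (hsg : s ≠ g) (a : A) (a₁' a₂' : A) :
    (⨆ π : Pol S A, occSA γ P π.1 (s, a) (g, a₁') / occSA γ P π.1 (g, a₁') (g, a₁')) =
      ⨆ π : Pol S A, occSA γ P π.1 (s, a) (g, a₂') / occSA γ P π.1 (g, a₂') (g, a₂') := by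
  exact le_antisymm (sup_le_aux hγ0 hγ1 hP s g hsg a a₁' a₂')
    (sup_le_aux hγ0 hγ1 hP s g hsg a a₂' a₁')
end

section
/- Consider a controlled Markov process with finite nonempty state space S, finite nonempty action space A, row-stochastic dynamics P : S → A → S → ℝ, and discount γ ∈ (0,1). Define the multiplicative successor value on state-action pairs by DSA (s,a) (g,a') = ⨆_{π ∈ Π} occSA γ π (s,a) (g,a') / occSA γ π (g,a') (g,a'). Then DSA is a (multiplicative) quasimetric on S × A: (i) DSA (s,a) (g,a') ≤ 1 for all pairs; (ii) DSA (s,a) (s,a) = 1, and DSA (s,a) (g,a') ≤ γ whenever (s,a) ≠ (g,a'); (iii) DSA (s,a_s) (g,a_g) ≥ DSA (s,a_s) (w,a_w) · DSA (w,a_w) (g,a_g) for all s, w, g ∈ S and a_s, a_w, a_g ∈ A. (Paper's Corollary 4.7: the successor distance d_SD = −log DSA is a quasimetric over S × A.) -/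
open scoped BigOperators

variable {S A : Type*} [Fintype S] [DecidableEq S] [Nonempty S]
  [Fintype A] [DecidableEq A] [Nonempty A]

/-- Multiplicative successor value on state-action pairs. -/
noncomputable def DSA (γ : ℝ) (P : S → A → S → ℝ) (x y : S × A) : ℝ :=
  ⨆ π : Pol S A, occSA γ P π.1 x y / occSA γ P π.1 y y

theorem qm_min_principle {X : Type*} [Fintype X] [Nonempty X] (γ : ℝ) (hγ0 : 0 < γ) (hγ1 : γ < 1)
    (Q : Matrix X X ℝ) (hQ0 : ∀ x y, 0 ≤ Q x y) (hQ1 : ∀ x, ∑ y, Q x y = 1) (D : X → ℝ)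
    (hD : ∀ x, 0 ≤ D x ∨ γ * ∑ z, Q x z * D z ≤ D x) : ∀ x, 0 ≤ D x := by
  obtain ⟨x0, hx0⟩ := Finite.exists_min D
  suffices h : 0 ≤ D x0 from fun x => h.trans (hx0 x)
  rcases hD x0 with h | h
  · exact h
  · have h1 : D x0 ≤ ∑ z, Q x0 z * D z := by
      calc D x0 = ∑ z, Q x0 z * D x0 := by rw [← Finset.sum_mul, hQ1, one_mul]
        _ ≤ _ := Finset.sum_le_sum fun z _ => mul_le_mul_of_nonneg_left (hx0 z) (hQ0 x0 z)
    have h2 := mul_le_mul_of_nonneg_left h1 hγ0.le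
    by_contra hn
    nlinarith

theorem qm_pow_bound {X : Type*} [Fintype X] [DecidableEq X]
    (Q : Matrix X X ℝ) (hQ0 : ∀ x y, 0 ≤ Q x y) (hQ1 : ∀ x, ∑ y, Q x y = 1) (t : ℕ) :
    ∀ x y, 0 ≤ (Q ^ t) x y ∧ (Q ^ t) x y ≤ 1 := by
  induction t with
  | zero => intro x y; rw [pow_zero, Matrix.one_apply]; split_ifs <;> norm_num
  | succ t ih =>
    intro x y
    rw [pow_succ', Matrix.mul_apply]
    refine ⟨Finset.sum_nonneg fun z _ => mul_nonneg (hQ0 x z) (ih z y).1, ?_⟩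
    calc _ ≤ ∑ z, Q x z := Finset.sum_le_sum fun z _ =>
          mul_le_of_le_one_right (hQ0 x z) (ih z y).2
      _ = 1 := hQ1 x

theorem qm_summable {X : Type*} [Fintype X] [DecidableEq X] (γ : ℝ) (hγ0 : 0 < γ) (hγ1 : γ < 1)
    (Q : Matrix X X ℝ) (hQ0 : ∀ x y, 0 ≤ Q x y) (hQ1 : ∀ x, ∑ y, Q x y = 1) (x y : X) :
    Summable fun t : ℕ => γ ^ t * (Q ^ t) x y := by
  refine Summable.of_nonneg_of_le (fun t => ?_) (fun t => ?_)
    (summable_geometric_of_lt_one hγ0.le hγ1)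
  · exact mul_nonneg (by positivity) (qm_pow_bound Q hQ0 hQ1 t x y).1
  · exact mul_le_of_le_one_right (by positivity) (qm_pow_bound Q hQ0 hQ1 t x y).2

theorem qm_Q {S A : Type*} [Fintype S] [Fintype A] (P : S → A → S → ℝ) (hP : IsDynamics P)
    (π : S → A → ℝ) (hπ : IsPolicy π) :
    (∀ x y, 0 ≤ Qmat P π x y) ∧ ∀ x, ∑ y, Qmat P π x y = 1 := by
  refine ⟨fun x y => mul_nonneg (hP.1 _ _ _) (hπ.1 _ _), fun x => ?_⟩
  simp only [Qmat, Fintype.sum_prod_type, ← Finset.mul_sum, hπ.2, mul_one, hP.2]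

theorem qm_occ_eq {S A : Type*} [Fintype S] [DecidableEq S] [Fintype A] [DecidableEq A]
    (γ : ℝ) (hγ0 : 0 < γ) (hγ1 : γ < 1)
    (P : S → A → S → ℝ) (hP : IsDynamics P) (π : S → A → ℝ) (hπ : IsPolicy π) (x y : S × A) :
    occSA γ P π x y = (1 - γ) * (if x = y then 1 else 0)
      + γ * ∑ z, Qmat P π x z * occSA γ P π z y := by
  obtain ⟨hQ0, hQ1⟩ := qm_Q P hP π hπ
  have hs := qm_summable γ hγ0 hγ1 _ hQ0 hQ1
  have h1 : ∑' t : ℕ, γ ^ (t + 1) * (Qmat P π ^ (t + 1)) x y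
      = γ * ∑ z, Qmat P π x z * ∑' t : ℕ, γ ^ t * (Qmat P π ^ t) z y := by
    simp_rw [← tsum_mul_left]
    rw [← Summable.tsum_finsetSum (fun z _ => (hs z y).mul_left _), ← tsum_mul_left]
    refine tsum_congr fun t => ?_
    rw [pow_succ' (Qmat P π), Matrix.mul_apply, Finset.mul_sum, Finset.mul_sum]
    exact Finset.sum_congr rfl fun z _ => by ring
  unfold occSA
  rw [(hs x y).tsum_eq_zero_add, h1, pow_zero, pow_zero, Matrix.one_apply]
  simp_rw [Finset.mul_sum]
  rw [mul_add, Finset.mul_sum, one_mul]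
  congr 1
  exact Finset.sum_congr rfl fun z _ => by ring

/-- normalized hitting value -/
noncomputable def qmH {S A : Type*} [Fintype S] [DecidableEq S] [Fintype A] [DecidableEq A]
    (γ : ℝ) (P : S → A → S → ℝ) (π : S → A → ℝ) (y x : S × A) : ℝ :=
  occSA γ P π x y / occSA γ P π y y

theorem qm_H {S A : Type*} [Fintype S] [DecidableEq S] [Fintype A] [DecidableEq A]
    (γ : ℝ) (hγ0 : 0 < γ) (hγ1 : γ < 1)
    (P : S → A → S → ℝ) (hP : IsDynamics P) (π : S → A → ℝ) (hπ : IsPolicy π) (y : S × A) :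
    qmH γ P π y y = 1 ∧
      (∀ x, x ≠ y → qmH γ P π y x = γ * ∑ z, Qmat P π x z * qmH γ P π y z) ∧
      (∀ x, 0 ≤ qmH γ P π y x) ∧ (∀ x, qmH γ P π y x ≤ 1) ∧ 
      (∀ x, x ≠ y → qmH γ P π y x ≤ γ) := by
  have : Nonempty (S × A) := ⟨y⟩
  obtain ⟨hQ0, hQ1⟩ := qm_Q P hP π hπ
  have he := fun x => qm_occ_eq γ hγ0 hγ1 P hP π hπ x y
  have h0 : ∀ x, 0 ≤ occSA γ P π x y := by
    refine qm_min_principle γ hγ0 hγ1 _ hQ0 hQ1 _ fun x => Or.inr ?_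
    rw [he x]
    have : 0 ≤ (1 - γ) * (if x = y then (1:ℝ) else 0) :=
      mul_nonneg (by linarith) (by split_ifs <;> norm_num)
    linarith
  have hpos : 0 < occSA γ P π y y := by
    rw [he y, if_pos rfl]
    have : 0 ≤ γ * ∑ z, Qmat P π y z * occSA γ P π z y :=
      mul_nonneg hγ0.le (Finset.sum_nonneg fun z _ => mul_nonneg (hQ0 _ _) (h0 z))
    linarith
  have hyy : qmH γ P π y y = 1 := div_self hpos.ne'
  have heq : ∀ x, x ≠ y → qmH γ P π y x = γ * ∑ z, Qmat P π x z * qmH γ P π y z := by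
    intro x hx
    have := he x
    rw [if_neg hx, mul_zero, zero_add] at this
    unfold qmH
    simp_rw [← mul_div_assoc]
    rw [← Finset.sum_div, ← mul_div_assoc, ← this]
  have h1 : ∀ x, qmH γ P π y x ≤ 1 := by
    intro x
    have := qm_min_principle γ hγ0 hγ1 _ hQ0 hQ1 (fun x => 1 - qmH γ P π y x) (fun x => ?_) x
    · linarith
    · by_cases hx : x = y
      · left; rw [hx, hyy]; norm_num
      · right
        simp only [mul_sub, mul_one, Finset.sum_sub_distrib, hQ1]
        rw [← heq x hx]; linarith
  refine ⟨hyy, heq, fun x => div_nonneg (h0 x) hpos.le, h1, fun x hx => ?_⟩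
  rw [heq x hx]
  refine mul_le_of_le_one_right hγ0.le ?_
  rw [← hQ1 x]
  exact Finset.sum_le_sum fun z _ => mul_le_of_le_one_right (hQ0 x z) (h1 z)

theorem qm_fix {S A : Type*} [Fintype S] [DecidableEq S] [Fintype A] [DecidableEq A] [Nonempty A]
    (γ : ℝ) (hγ0 : 0 < γ) (hγ1 : γ < 1)
    (P : S → A → S → ℝ) (hP : IsDynamics P) (y : S × A) :
    ∃ q : S × A → ℝ, q y = 1 ∧ ∀ x, x ≠ y → q x = γ * ∑ s, P x.1 x.2 s *
      Finset.univ.sup' Finset.univ_nonempty (fun a => q (s, a)) := by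
  let T : (S × A → ℝ) → (S × A → ℝ) := fun q x => if x = y then 1 else
    γ * ∑ s, P x.1 x.2 s * Finset.univ.sup' Finset.univ_nonempty (fun a => q (s, a))
  have key : ∀ q r x, T q x - T r x ≤ γ * dist q r := by
    intro q r x
    simp only [T]
    split_ifs
    · rw [sub_self]; positivity
    · rw [← mul_sub, ← Finset.sum_sub_distrib]
      refine mul_le_mul_of_nonneg_left ?_ hγ0.le
      calc _ ≤ ∑ s, P x.1 x.2 s * dist q r := by
            refine Finset.sum_le_sum fun s _ => ?_
            rw [← mul_sub]
            refine mul_le_mul_of_nonneg_left ?_ (hP.1 _ _ _)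
            rw [sub_le_iff_le_add]
            refine Finset.sup'_le _ _ fun a _ => ?_
            have h1 := Finset.le_sup' (fun a => r (s, a)) (Finset.mem_univ a)
            have h2 := dist_le_pi_dist q r (s, a)
            rw [Real.dist_eq] at h2
            have h3 := le_abs_self (q (s, a) - r (s, a))
            linarith
        _ = dist q r := by rw [← Finset.sum_mul, hP.2, one_mul]
  have hT : ContractingWith ⟨γ, hγ0.le⟩ T := by
    refine ⟨by exact_mod_cast hγ1, LipschitzWith.of_dist_le_mul fun q r => ?_⟩
    refine (dist_pi_le_iff (mul_nonneg hγ0.le dist_nonneg)).2 fun x => ?_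
    rw [Real.dist_eq, abs_le]
    have h1 := key q r x
    have h2 := key r q x
    rw [dist_comm r q] at h2
    change -(γ * dist q r) ≤ _ ∧ _ ≤ γ * dist q r
    constructor <;> linarith
  have hf := hT.fixedPoint_isFixedPt
  refine ⟨hT.fixedPoint, ?_, fun x hx => ?_⟩
  · rw [← hf]; simp [T]
  · conv_lhs => rw [← hf]
    simp only [T, if_neg hx]

theorem qm_opt {S A : Type*} [Fintype S] [DecidableEq S] [Fintype A] [DecidableEq A] [Nonempty A]
    (γ : ℝ) (hγ0 : 0 < γ) (hγ1 : γ < 1)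
    (P : S → A → S → ℝ) (hP : IsDynamics P) (y : S × A) :
    ∃ π₀, IsPolicy π₀ ∧ ∀ π, IsPolicy π → ∀ x,
      γ * ∑ z, Qmat P π x z * qmH γ P π₀ y z ≤ qmH γ P π₀ y x := by
  have : Nonempty (S × A) := ⟨y⟩
  obtain ⟨q, hqy, hq⟩ := qm_fix γ hγ0 hγ1 P hP y
  have hmax : ∀ s, ∃ b, ∀ a, q (s, a) ≤ q (s, b) := fun s => Finite.exists_max fun a => q (s, a)
  choose b hb using hmax
  have hsup : ∀ s, Finset.univ.sup' Finset.univ_nonempty (fun a => q (s, a)) = q (s, b s) :=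
    fun s => le_antisymm (Finset.sup'_le _ _ fun a _ => hb s a)
      (Finset.le_sup' (fun a => q (s, a)) (Finset.mem_univ _))
  simp_rw [hsup] at hq
  let π₀ : S → A → ℝ := fun s a => if a = b s then 1 else 0
  have hπ₀ : IsPolicy π₀ := ⟨fun s a => by simp only [π₀]; split_ifs <;> norm_num,
    fun s => by simp [π₀]⟩
  obtain ⟨hQ0, hQ1⟩ := qm_Q P hP π₀ hπ₀
  obtain ⟨hyy, heq, h0, h1, h2⟩ := qm_H γ hγ0 hγ1 P hP π₀ hπ₀ y
  have hQq : ∀ x, ∑ z, Qmat P π₀ x z * q z = ∑ s, P x.1 x.2 s * q (s, b s) := by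
    intro x
    simp [Qmat, Fintype.sum_prod_type, π₀]
  have hle : ∀ x, qmH γ P π₀ y x = q x := by
    intro x
    have e1 := qm_min_principle γ hγ0 hγ1 _ hQ0 hQ1 (fun x => qmH γ P π₀ y x - q x) (fun x => ?_) x
    have e2 := qm_min_principle γ hγ0 hγ1 _ hQ0 hQ1 (fun x => q x - qmH γ P π₀ y x) (fun x => ?_) x
    · linarith
    all_goals
      by_cases hx : x = y
      · left; rw [hx, hyy, hqy, sub_self]
      · right
        simp only [mul_sub, Finset.sum_sub_distrib]
        rw [← heq x hx, hQq, ← hq x hx]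
  refine ⟨π₀, hπ₀, fun π hπ x => ?_⟩
  obtain ⟨hR0, hR1⟩ := qm_Q P hP π hπ
  by_cases hx : x = y
  · rw [hx, hyy]
    have : ∑ z, Qmat P π y z * qmH γ P π₀ y z ≤ 1 := by
      rw [← hR1 y]
      exact Finset.sum_le_sum fun z _ => mul_le_of_le_one_right (hR0 y z) (h1 z)
    nlinarith
  · simp_rw [hle]
    rw [hq x hx]
    refine mul_le_mul_of_nonneg_left ?_ hγ0.le
    rw [Fintype.sum_prod_type]
    refine Finset.sum_le_sum fun s _ => ?_
    calc _ ≤ ∑ a, P x.1 x.2 s * π s a * q (s, b s) := Finset.sum_le_sum fun a _ =>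
          mul_le_mul_of_nonneg_left (hb s a) (hR0 x (s, a))
      _ = _ := by rw [← Finset.sum_mul, ← Finset.mul_sum, hπ.2, mul_one]

/-- `DSA` is a multiplicative quasimetric on `S × A` (Corollary 4.7): positivity,
identity, and the multiplicative triangle inequality. -/
theorem DSA_quasimetric (γ : ℝ) (hγ0 : 0 < γ) (hγ1 : γ < 1)
    (P : S → A → S → ℝ) (hP : IsDynamics P) :
    (∀ x y : S × A, DSA γ P x y ≤ 1) ∧
      ((∀ x : S × A, DSA γ P x x = 1) ∧
        ∀ x y : S × A, x ≠ y → DSA γ P x y ≤ γ) ∧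
      (∀ x w y : S × A, DSA γ P x y ≥ DSA γ P x w * DSA γ P w y) := by
  classical
  have hbdd : ∀ x y : S × A, BddAbove (Set.range fun π : Pol S A => qmH γ P π.1 y x) := by
    rintro x y
    refine ⟨1, ?_⟩
    rintro _ ⟨π, rfl⟩
    exact (qm_H γ hγ0 hγ1 P hP π.1 π.2 y).2.2.2.1 x
  have hD : ∀ x y, DSA γ P x y = ⨆ π : Pol S A, qmH γ P π.1 y x := fun x y => rfl
  have : Nonempty (Pol S A) := by
    obtain ⟨x⟩ := (inferInstance : Nonempty (S × A))
    obtain ⟨π₀, h, _⟩ := qm_opt γ hγ0 hγ1 P hP x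
    exact ⟨⟨π₀, h⟩⟩
  refine ⟨fun x y => ?_, ⟨fun x => ?_, fun x y hxy => ?_⟩, fun x w y => ?_⟩
  · rw [hD]
    exact ciSup_le fun π => (qm_H γ hγ0 hγ1 P hP π.1 π.2 y).2.2.2.1 x
  · rw [hD]
    simp_rw [fun π : Pol S A => (qm_H γ hγ0 hγ1 P hP π.1 π.2 x).1]
    exact ciSup_const
  · rw [hD]
    exact ciSup_le fun π => (qm_H γ hγ0 hγ1 P hP π.1 π.2 y).2.2.2.2 x hxy
  · have : Nonempty (S × A) := ⟨x⟩
    obtain ⟨π₀, hπ₀, hopt⟩ := qm_opt γ hγ0 hγ1 P hP y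
    obtain ⟨hyy, heq, h0, h1, h2⟩ := qm_H γ hγ0 hγ1 P hP π₀ hπ₀ y
    have hge : ∀ x, qmH γ P π₀ y x ≤ DSA γ P x y := fun x => by
      rw [hD]; exact le_ciSup (hbdd x y) ⟨π₀, hπ₀⟩
    have hmul : ∀ (π : Pol S A) (v : S × A) (x : S × A),
        qmH γ P π.1 v x * qmH γ P π₀ y v ≤ qmH γ P π₀ y x := by
      intro π v x
      obtain ⟨hQ0, hQ1⟩ := qm_Q P hP π.1 π.2
      obtain ⟨kyy, keq, -⟩ := qm_H γ hγ0 hγ1 P hP π.1 π.2 v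
      have := qm_min_principle γ hγ0 hγ1 _ hQ0 hQ1
        (fun x => qmH γ P π₀ y x - qmH γ P π.1 v x * qmH γ P π₀ y v) (fun x => ?_) x
      · linarith
      · by_cases hx : x = v
        · left; rw [hx, kyy]; linarith
        · right
          simp only [mul_sub, Finset.sum_sub_distrib, ← mul_assoc]
          rw [← Finset.sum_mul, ← mul_assoc, ← keq x hx]
          linarith [hopt π.1 π.2 x]
    have hDw : DSA γ P w y ≤ qmH γ P π₀ y w := by
      rw [hD]
      refine ciSup_le fun π => ?_
      have := hmul π y w
      rwa [hyy, mul_one] at this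
    have hDx : 0 ≤ DSA γ P x w := by
      rw [hD]
      exact Real.iSup_nonneg fun π => (qm_H γ hγ0 hγ1 P hP π.1 π.2 w).2.2.1 x
    refine ge_iff_le.2 ((mul_le_mul_of_nonneg_left hDw hDx).trans (le_trans ?_ (hge x)))
    rw [hD, Real.iSup_mul_of_nonneg (h0 w)]
    exact ciSup_le fun π => hmul π w x
end

section
/- Let P be a row-stochastic matrix on a finite nonempty state space S and γ ∈ (0,1). Suppose the state g is absorbing, i.e., P g g = 1, and suppose the hitting time of g from s is deterministic and equal to h₀, i.e., f h₀ s g = 1 for the first-passage probabilities f. Then occ γ P g g = 1 and occ γ P s g = γ^{h₀}; consequently the successor distance satisfies log(occ γ P g g) − log(occ γ P s g) = h₀ · log(1/γ). (The paper's 'hitting times as a special case': when the agent can remain at the goal and the hitting time is deterministic, the successor distance is proportional to the hitting time.) -/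
open scoped BigOperators

variable {S : Type*} [Fintype S] [DecidableEq S] [Nonempty S]

theorem aux_gg {S : Type*} [Fintype S] [DecidableEq S] (P : Matrix S S ℝ)
    (h0 : ∀ s s', 0 ≤ P s s') (h1 : ∀ s, ∑ s', P s s' = 1) (g : S) (habs : P g g = 1) (t : ℕ) :
    (P ^ t) g g = 1 := by
  have hz : ∀ x, x ≠ g → P g x = 0 := by
    intro x hx
    have h := h1 g
    rw [← Finset.add_sum_erase _ _ (Finset.mem_univ g), habs] at h
    have h2 : ∑ x ∈ Finset.univ.erase g, P g x = 0 := by linarith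
    rw [Finset.sum_eq_zero_iff_of_nonneg (fun i _ => h0 g i)] at h2
    exact h2 x (by simp [hx])
  induction t with
  | zero => simp
  | succ t ih =>
    rw [pow_succ', Matrix.mul_apply, Finset.sum_eq_single g]
    · rw [habs, ih, one_mul]
    · intro b _ hb
      rw [hz b hb, zero_mul]
    · simp

theorem aux_sum_s19 {S : Type*} [Fintype S] [DecidableEq S] (P : Matrix S S ℝ)
    (h0 : ∀ s s', 0 ≤ P s s') (h1 : ∀ s, ∑ s', P s s' = 1) (g : S) (habs : P g g = 1) (t : ℕ) :
    ∀ s, ∑ h ∈ Finset.range (t + 1), fp P h s g = (P ^ t) s g := by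
  induction t with
  | zero => intro s; simp [fp, Matrix.one_apply]
  | succ t ih =>
    intro s
    rw [Finset.sum_range_succ']
    by_cases hs : s = g
    · subst hs
      rw [aux_gg P h0 h1 s habs]
      simp [fp]
    · simp only [fp, if_neg hs, add_zero]
      rw [Finset.sum_comm, pow_succ', Matrix.mul_apply]
      refine Finset.sum_congr rfl fun x _ => ?_
      rw [← Finset.mul_sum, ih]

theorem aux_nonneg {S : Type*} [Fintype S] [DecidableEq S] (P : Matrix S S ℝ)
    (h0 : ∀ s s', 0 ≤ P s s') (g : S) (t : ℕ) : ∀ s, 0 ≤ fp P t s g := by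
  induction t with
  | zero => intro s; simp only [fp]; split_ifs <;> norm_num
  | succ t ih =>
    intro s
    simp only [fp]
    split_ifs
    · exact le_rfl
    · exact Finset.sum_nonneg fun x _ => mul_nonneg (h0 _ _) (ih x)

theorem aux_le_s19 {S : Type*} [Fintype S] [DecidableEq S] (P : Matrix S S ℝ)
    (h0 : ∀ s s', 0 ≤ P s s') (h1 : ∀ s, ∑ s', P s s' = 1) (g : S) (t : ℕ) :
    ∀ s, (P ^ t) s g ≤ 1 := by
  induction t with
  | zero => intro s; rw [pow_zero, Matrix.one_apply]; split_ifs <;> norm_num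
  | succ t ih =>
    intro s
    rw [pow_succ', Matrix.mul_apply, ← h1 s]
    exact Finset.sum_le_sum fun x _ => mul_le_of_le_one_right (h0 _ _) (ih x)

theorem aux_occ {S : Type*} [Fintype S] [DecidableEq S] (γ : ℝ) (hγ0 : 0 < γ) (hγ1 : γ < 1)
    (P : Matrix S S ℝ) (h0 : ∀ s s', 0 ≤ P s s') (h1 : ∀ s, ∑ s', P s s' = 1) (s g : S)
    (habs : P g g = 1) (n : ℕ) (hhit : fp P n s g = 1) :
    occ γ P s g = γ ^ n := by
  have hlo : ∀ t, t < n → (P ^ t) s g = 0 := by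
    intro t ht
    have hn := aux_le_s19 P h0 h1 g n s
    rw [← aux_sum_s19 P h0 h1 g habs, Finset.sum_range_succ, hhit] at hn
    have h2 : ∑ h ∈ Finset.range (t + 1), fp P h s g ≤ ∑ h ∈ Finset.range n, fp P h s g :=
      Finset.sum_le_sum_of_subset_of_nonneg (by
        intro x; simp only [Finset.mem_range]; omega) (fun i _ _ => aux_nonneg P h0 g i s)
    have h3 : 0 ≤ ∑ h ∈ Finset.range (t + 1), fp P h s g :=
      Finset.sum_nonneg fun i _ => aux_nonneg P h0 g i s
    rw [← aux_sum_s19 P h0 h1 g habs]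
    linarith
  have hhi : ∀ t, (P ^ (t + n)) s g = 1 := by
    intro t
    refine le_antisymm (aux_le_s19 P h0 h1 g _ s) ?_
    rw [← aux_sum_s19 P h0 h1 g habs, ← hhit]
    exact Finset.single_le_sum (f := fun h => fp P h s g)
      (fun i _ => aux_nonneg P h0 g i s) (by simp only [Finset.mem_range]; omega)
  have hs : HasSum (fun t : ℕ => γ ^ t * (P ^ t) s g) ((1 - γ)⁻¹ * γ ^ n) := by
    rw [← hasSum_nat_add_iff' n, Finset.sum_eq_zero, sub_zero]
    · have := (hasSum_geometric_of_lt_one hγ0.le hγ1).mul_right (γ ^ n)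
      simpa only [hhi, mul_one, pow_add] using this
    · intro i hi
      rw [hlo i (Finset.mem_range.1 hi), mul_zero]
  have : 1 - γ ≠ 0 := by linarith
  rw [occ, hs.tsum_eq, ← mul_assoc, mul_inv_cancel₀ this, one_mul]

/-- When the goal is absorbing and the hitting time is deterministic, the
successor distance is proportional to the hitting time. -/
theorem successor_distance_eq_hitting_time (γ : ℝ) (hγ0 : 0 < γ) (hγ1 : γ < 1)
    (P : Matrix S S ℝ) (hP : IsStochastic P) (s g : S)
    (habs : P g g = 1) (h₀ : ℕ) (hhit : fp P h₀ s g = 1) :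
    occ γ P g g = 1 ∧ occ γ P s g = γ ^ h₀ ∧
      Real.log (occ γ P g g) - Real.log (occ γ P s g) = h₀ * Real.log (1 / γ) := by
  have hg : occ γ P g g = 1 := by
    simpa using aux_occ γ hγ0 hγ1 P hP.1 hP.2 g g habs 0 (by simp [fp])
  have hs := aux_occ γ hγ0 hγ1 P hP.1 hP.2 s g habs h₀ hhit
  refine ⟨hg, hs, ?_⟩
  rw [hg, hs, Real.log_one, Real.log_pow, one_div, Real.log_inv]
  ring
end
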